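/- arXiv:1809.03090 — 2 statements merged into one kernel-verified Lean document; each statement's English description precedes it below -/
import Mathlib

section
/- For every positive integer M and every v > 0 there exists a subfamily F̃ ⊆ F_{L,v} whose cardinality is at most exp((L−2)·M·log(min{d̄, 2M}) + M·log(8e·d_in)), such that for every probability measure P on [−1,1]^{d_in} and every depth-L nonnegative-weight ramp network W with composite variation v(W) ≤ v there is a function f̃ ∈ F̃ with ∫ |f(W,x) − f̃(x)|² P(dx) ≤ L²·v²/M. -/
open MeasureTheory

noncomputable section

/-- Entrywise `ℓ¹` norm of the top-left `m × n` block of an array of reals. -/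
def ell1 (m n : ℕ) (A : ℕ → ℕ → ℝ) : ℝ :=
  ∑ i ∈ Finset.range m, ∑ j ∈ Finset.range n, |A i j|

/-- Product of the layer matrices `W a, W (a+1), …, W (a+n-1)`, viewed as a map from
layer `a` to layer `a + n`.  Here `W ℓ` denotes the `d ℓ × d (ℓ+1)` matrix between
layer `ℓ` and layer `ℓ + 1` (in the paper's notation, `W ℓ = W_{ℓ+1}`). -/
def layerProd (d : ℕ → ℕ) (W : ℕ → ℕ → ℕ → ℝ) (a : ℕ) : ℕ → ℕ → ℕ → ℝ
  | 0 => fun i j => if i = j then (1 : ℝ) else 0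
  | n + 1 => fun i k =>
      ∑ j ∈ Finset.range (d (a + n)), layerProd d W a n i j * W (a + n) j k

/-- A depth-`L` nonnegative-weight ramp network.  Layers are indexed by `ℓ = 0` (output)
through `ℓ = L` (the doubled input layer), with `d 0 = 1`.  The scalar `w0` is the output
weight and `W ℓ` is the paper's matrix `W_{ℓ+1} ∈ ℝ^{d_ℓ × d_{ℓ+1}}` (only the entries
with indices `< d ℓ`, `< d (ℓ+1)` are relevant). -/
structure RampNet (L d_in : ℕ) (d : ℕ → ℕ) where
  w0 : ℝ
  W : ℕ → ℕ → ℕ → ℝ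
  w0_nonneg : 0 ≤ w0
  W_nonneg : ∀ ℓ i j, 0 ≤ W ℓ i j

namespace RampNet

variable {L d_in : ℕ} {d : ℕ → ℕ}

/-- `zRev L d_in d W x k` is the vector `z^{(L-k)}` of unit outputs at layer `L - k`:
`z^{(L)}` is the doubled input and `z^{(ℓ)}_j = ±max((W_{ℓ+1} z^{(ℓ+1)})_j, 0)`, the sign
depending on whether `j` is in the first half of the layer. -/
def zRev (L d_in : ℕ) (d : ℕ → ℕ) (W : ℕ → ℕ → ℕ → ℝ) (x : ℕ → ℝ) : ℕ → ℕ → ℝ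
  | 0 => fun j => if j < d_in then x j else -x (j - d_in)
  | k + 1 => fun j =>
      if j < d (L - (k + 1)) / 2 then
        max (∑ i ∈ Finset.range (d (L - k)), W (L - (k + 1)) j i * zRev L d_in d W x k i) 0
      else
        -max (∑ i ∈ Finset.range (d (L - k)), W (L - (k + 1)) j i * zRev L d_in d W x k i) 0

/-- The network function `f(W,x) = w0 · (W_1 z^{(1)})`. -/
def eval (net : RampNet L d_in d) (x : ℕ → ℝ) : ℝ :=
  net.w0 * ∑ j ∈ Finset.range (d 1), net.W 0 0 j * zRev L d_in d net.W x (L - 1) j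

/-- The subnetwork variation `V_ℓ^{out}(W) = w0 · ‖W_1 ⋯ W_ℓ‖₁` (equal to `w0` at `ℓ = 0`). -/
def Vout (net : RampNet L d_in d) (ℓ : ℕ) : ℝ :=
  net.w0 * ell1 (d 0) (d ℓ) (layerProd d net.W 0 ℓ)

/-- The subnetwork variation `V_ℓ^{in}(W) = ‖W_{ℓ+1} ⋯ W_L‖₁`. -/
def Vin (net : RampNet L d_in d) (ℓ : ℕ) : ℝ :=
  ell1 (d ℓ) (d L) (layerProd d net.W ℓ (L - ℓ))

/-- The variation `V(W) = w0 · ‖W_1 W_2 ⋯ W_L‖₁`. -/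
def Vtot (net : RampNet L d_in d) : ℝ :=
  net.w0 * ell1 (d 0) (d L) (layerProd d net.W 0 L)

/-- The average variation `V̄(W) = (1/L) Σ_{ℓ=0}^{L-1} (V_ℓ^{out} + V_ℓ^{in})/2`. -/
def Vbar (net : RampNet L d_in d) : ℝ :=
  (1 / (L : ℝ)) * ∑ ℓ ∈ Finset.range L, (net.Vout ℓ + net.Vin ℓ) / 2

/-- The composite variation `v(W) = V̄(W) · √(V(W))`. -/
def compVar (net : RampNet L d_in d) : ℝ :=
  net.Vbar * Real.sqrt net.Vtot

end RampNet

/-- The class `F_{L,v}` of depth-`L` ramp-network functions with composite variation at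
most `v` (as functions of the input coordinates `x : ℕ → ℝ`, only the first `d_in` of
which matter). -/
def FLv (L d_in : ℕ) (d : ℕ → ℕ) (v : ℝ) : Set ((ℕ → ℝ) → ℝ) :=
  {g | ∃ net : RampNet L d_in d, net.compVar ≤ v ∧ ∀ x, g x = net.eval x}

/-- The geometric mean `d̄` of `d 2, …, d (L-1)` (equal to `1` when `L = 2`). -/
def dbar (L : ℕ) (d : ℕ → ℕ) : ℝ :=
  (∏ ℓ ∈ Finset.Icc 2 (L - 1), (d ℓ : ℝ)) ^ (((L : ℝ) - 2)⁻¹)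

/-- An eigenvector-type relation across consecutive layers passes to layer products. -/
theorem layerProd_mulVec (d : ℕ → ℕ) (W : ℕ → ℕ → ℕ → ℝ) (u : ℕ → ℕ → ℝ) (a n : ℕ)
    (h : ∀ ℓ, a ≤ ℓ → ℓ < a + n → ∀ j < d ℓ,
      ∑ i ∈ Finset.range (d (ℓ + 1)), W ℓ j i * u (ℓ + 1) i = u ℓ j)
    {i : ℕ} (hi : i < d a) :
    ∑ k ∈ Finset.range (d (a + n)), layerProd d W a n i k * u (a + n) k = u a i := by
  induction n with
  | zero => simp [layerProd, hi]
  | succ n ih =>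
    have ih' := ih fun ℓ h₁ h₂ => h ℓ h₁ (by omega)
    rw [← ih', ← add_assoc]
    simp only [layerProd, Finset.sum_mul]
    rw [Finset.sum_comm]
    refine Finset.sum_congr rfl fun j hj => ?_
    rw [← h (a + n) (by omega) (by omega) j (Finset.mem_range.1 hj), Finset.mul_sum]
    exact Finset.sum_congr rfl fun k _ => by ring

theorem layerProd_nonneg (d : ℕ → ℕ) {W : ℕ → ℕ → ℕ → ℝ} (hW : ∀ ℓ i j, 0 ≤ W ℓ i j)
    (a n i k : ℕ) : 0 ≤ layerProd d W a n i k := by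
  induction n generalizing k with
  | zero => simp only [layerProd]; split_ifs <;> norm_num
  | succ n ih => exact Finset.sum_nonneg fun j _ => mul_nonneg (ih j) (hW _ _ _)

/-- Consistent nonnegative pair marginals on consecutive layers are the pair marginals of a
probability on paths. -/
theorem exists_path_space (d : ℕ → ℕ) (pr : ℕ → ℕ → ℕ → ℝ) (p : ℕ → ℕ → ℝ) (L : ℕ)
    (hpr : ∀ ℓ i j, 0 ≤ pr ℓ i j) (hp : ∀ ℓ i, 0 ≤ p ℓ i)
    (hp0 : ∑ i ∈ Finset.range (d 0), p 0 i = 1)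
    (hrow : ∀ ℓ < L, ∀ i < d ℓ, ∑ j ∈ Finset.range (d (ℓ + 1)), pr ℓ i j = p ℓ i)
    (hcol : ∀ ℓ < L, ∀ j < d (ℓ + 1), ∑ i ∈ Finset.range (d ℓ), pr ℓ i j = p (ℓ + 1) j) :
    ∃ (Ω : Type) (_ : Fintype Ω) (P : Ω → ℝ) (J : ℕ → Ω → ℕ),
      (∀ ω, 0 ≤ P ω) ∧ ∑ ω, P ω = 1 ∧ (∀ ℓ ≤ L, ∀ ω, J ℓ ω < d ℓ) ∧
      (∀ ℓ ≤ L, ∀ h : ℕ → ℝ, ∑ ω, P ω * h (J ℓ ω) = ∑ i ∈ Finset.range (d ℓ), p ℓ i * h i) ∧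
      ∀ ℓ < L, ∀ h : ℕ → ℕ → ℝ, ∑ ω, P ω * h (J ℓ ω) (J (ℓ + 1) ω) =
        ∑ i ∈ Finset.range (d ℓ), ∑ j ∈ Finset.range (d (ℓ + 1)), pr ℓ i j * h i j := by
  induction L with
  | zero =>
    refine ⟨Fin (d 0), inferInstance, fun ω => p 0 ω, fun _ ω => ω, fun ω => hp _ _, ?_, ?_, ?_, ?_⟩
    · rw [← hp0, Finset.sum_range]
    · intro ℓ hℓ ω
      obtain rfl : ℓ = 0 := by omega
      exact ω.2
    · intro ℓ hℓ h
      obtain rfl : ℓ = 0 := by omega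
      rw [Finset.sum_range]
    · intro ℓ hℓ
      omega
  | succ L ih =>
    obtain ⟨Ω, _, P, J, hP, hP1, hJ, hmarg, hpair⟩ :=
      ih (fun ℓ hℓ => hrow ℓ (by omega)) (fun ℓ hℓ => hcol ℓ (by omega))
    have hcancel : ∀ ω, P ω * (p L (J L ω) / p L (J L ω)) = P ω := by
      intro ω
      by_cases hz : p L (J L ω) = 0
      · have h1 := hmarg L le_rfl (fun i => if i = J L ω then 1 else 0)
        simp only [mul_ite, mul_one, mul_zero, Finset.sum_ite_eq', Finset.mem_range,
          hJ L le_rfl ω, if_true, hz] at h1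
        have h2 := (Finset.sum_eq_zero_iff_of_nonneg (fun ω' _ => by
          split_ifs
          · exact hP ω'
          · exact le_rfl)).1 h1 ω (Finset.mem_univ _)
        rw [if_pos rfl] at h2
        simp [h2]
      · rw [div_self hz, mul_one]
    have hrowL := hrow L (by omega)
    have hold : ∀ H : Ω → ℝ, ∑ w : Ω × Fin (d (L + 1)),
        P w.1 * (pr L (J L w.1) w.2 / p L (J L w.1)) * H w.1 = ∑ ω, P ω * H ω := by
      intro H
      rw [Fintype.sum_prod_type]
      refine Finset.sum_congr rfl fun ω _ => ?_
      dsimp only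
      rw [← Finset.sum_mul, ← Finset.mul_sum, ← Finset.sum_div,
        ← Finset.sum_range (fun j => pr L (J L ω) j), hrowL _ (hJ L le_rfl ω), hcancel]
    have hnew : ∀ h : ℕ → ℕ → ℝ, ∑ w : Ω × Fin (d (L + 1)),
        P w.1 * (pr L (J L w.1) w.2 / p L (J L w.1)) * h (J L w.1) w.2 =
        ∑ i ∈ Finset.range (d L), ∑ j ∈ Finset.range (d (L + 1)), pr L i j * h i j := by
      intro h
      rw [Fintype.sum_prod_type]
      have h1 := hmarg L le_rfl
        (fun i => (∑ j ∈ Finset.range (d (L + 1)), pr L i j * h i j) / p L i)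
      have h2 : ∀ i ∈ Finset.range (d L),
          p L i * ((∑ j ∈ Finset.range (d (L + 1)), pr L i j * h i j) / p L i) =
          ∑ j ∈ Finset.range (d (L + 1)), pr L i j * h i j := by
        intro i hi
        by_cases hz : p L i = 0
        · have h3 := hrowL i (Finset.mem_range.1 hi)
          rw [hz, Finset.sum_eq_zero_iff_of_nonneg fun j _ => hpr _ _ _] at h3
          rw [hz, zero_mul]
          exact (Finset.sum_eq_zero fun j hj => by rw [h3 j hj, zero_mul]).symm
        · rw [mul_div_cancel₀ _ hz]
      rw [Finset.sum_congr rfl h2] at h1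
      rw [← h1]
      refine Finset.sum_congr rfl fun ω _ => ?_
      rw [Finset.sum_range, Finset.sum_div, Finset.mul_sum]
      exact Finset.sum_congr rfl fun j _ => by ring
    refine ⟨Ω × Fin (d (L + 1)), inferInstance,
      fun w => P w.1 * (pr L (J L w.1) w.2 / p L (J L w.1)),
      fun ℓ w => if ℓ = L + 1 then w.2 else J ℓ w.1,
      fun w => mul_nonneg (hP _) (div_nonneg (hpr _ _ _) (hp _ _)), ?_, ?_, ?_, ?_⟩
    · simpa [hP1] using hold fun _ => 1
    · intro ℓ hℓ w
      by_cases hc : ℓ = L + 1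
      · subst hc; simp
      · simpa [hc] using hJ ℓ (by omega) w.1
    · intro ℓ hℓ h
      by_cases hc : ℓ = L + 1
      · subst hc
        simp only [if_true]
        rw [hnew fun _ j => h j, Finset.sum_comm]
        refine Finset.sum_congr rfl fun j hj => ?_
        rw [← hcol L (by omega) j (Finset.mem_range.1 hj), Finset.sum_mul]
      · simp only [hc, if_false]
        rw [hold fun ω => h (J ℓ ω), hmarg ℓ (by omega)]
    · intro ℓ hℓ h
      by_cases hc : ℓ = L
      · subst hc
        simpa using hnew h
      · have h1 : ℓ ≠ L + 1 := by omega
        have h2 : ℓ + 1 ≠ L + 1 := by omega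
        simp only [h1, h2, if_false]
        rw [hold fun ω => h (J ℓ ω) (J (ℓ + 1) ω), hpair ℓ (by omega)]

/-- The part of total mass one of a finite measure on which `f` is largest. -/
theorem exists_top_unit_mass {Ω : Type*} [Fintype Ω] (m f : Ω → ℝ) (hm : ∀ ω, 0 ≤ m ω)
    (h1 : 1 ≤ ∑ ω, m ω) :
    ∃ (q : Ω → ℝ) (t : ℝ), (∀ ω, 0 ≤ q ω) ∧ (∀ ω, q ω ≤ m ω) ∧ ∑ ω, q ω = 1 ∧
      (∀ ω, 0 < q ω → t ≤ f ω) ∧ ∀ ω, q ω < m ω → f ω ≤ t := by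
  classical
  let S := (Finset.univ.image f).filter fun t => 1 ≤ ∑ ω with t ≤ f ω, m ω
  have hne : (Finset.univ : Finset Ω).Nonempty := by
    by_contra h
    rw [Finset.not_nonempty_iff_eq_empty] at h
    rw [h] at h1
    norm_num at h1
  have hS : S.Nonempty := by
    obtain ⟨ω₀, -, h₀⟩ := Finset.exists_min_image Finset.univ f hne
    refine ⟨f ω₀, Finset.mem_filter.2 ⟨Finset.mem_image_of_mem _ (Finset.mem_univ _), ?_⟩⟩
    rwa [Finset.filter_true_of_mem fun ω hω => h₀ ω hω]
  obtain ⟨t, htS, htmax⟩ := S.exists_max_image id hS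
  have ht := (Finset.mem_filter.1 htS).2
  set a := ∑ ω with t < f ω, m ω with ha
  set b := ∑ ω with f ω = t, m ω with hb
  have ha1 : a < 1 := by
    by_contra hcon
    push Not at hcon
    have hne' : (Finset.univ.filter fun ω => t < f ω).Nonempty := by
      by_contra h
      rw [Finset.not_nonempty_iff_eq_empty] at h
      rw [ha, h] at hcon
      norm_num at hcon
    obtain ⟨ω₀, hω₀, hmin⟩ := Finset.exists_min_image _ f hne'
    have hlt := (Finset.mem_filter.1 hω₀).2
    have hmem : f ω₀ ∈ S := by
      refine Finset.mem_filter.2 ⟨Finset.mem_image_of_mem _ (Finset.mem_univ _), ?_⟩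
      refine hcon.trans (Finset.sum_le_sum_of_subset_of_nonneg ?_ fun ω _ _ => hm ω)
      intro ω hω
      exact Finset.mem_filter.2 ⟨Finset.mem_univ _, hmin ω hω⟩
    exact absurd (htmax _ hmem) (not_le.2 hlt)
  have hab : ∑ ω with t ≤ f ω, m ω = a + b := by
    rw [ha, hb, ← Finset.sum_union]
    · refine Finset.sum_congr ?_ fun _ _ => rfl
      ext ω
      simp [le_iff_lt_or_eq, eq_comm]
    · rw [Finset.disjoint_filter]
      intro ω _ h h'
      exact absurd h' h.ne'
  rw [hab] at ht
  have hb0 : 0 < b := by linarith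
  have hl0 : 0 ≤ (1 - a) / b := div_nonneg (by linarith) hb0.le
  have hl1 : (1 - a) / b ≤ 1 := (div_le_one hb0).2 (by linarith)
  refine ⟨fun ω => (if t < f ω then m ω else 0) + if f ω = t then (1 - a) / b * m ω else 0,
    t, ?_, ?_, ?_, ?_, ?_⟩
  · intro ω
    have := hm ω
    have := mul_nonneg hl0 (hm ω)
    dsimp only
    split_ifs <;> linarith
  · intro ω
    have h2 := mul_le_of_le_one_left (hm ω) hl1
    have := hm ω
    dsimp only
    split_ifs with h3 h4
    · exact absurd h4 h3.ne'
    all_goals linarith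
  · rw [Finset.sum_add_distrib, ← Finset.sum_filter, ← Finset.sum_filter, ← Finset.mul_sum,
      ← ha, ← hb, div_mul_cancel₀ _ hb0.ne']
    ring
  · intro ω hω
    by_contra hlt
    push Not at hlt
    simp [hlt.not_gt, hlt.ne] at hω
  · intro ω hω
    by_contra hlt
    push Not at hlt
    simp [hlt, hlt.ne'] at hω

/-- Slicing a measure of integer mass into unit masses along increasing values of `f`. -/
theorem exists_slices {Ω : Type*} [Fintype Ω] (f : Ω → ℝ) (n : ℕ) (m : Ω → ℝ)
    (hm : ∀ ω, 0 ≤ m ω) (hmass : ∑ ω, m ω = n) (T : ℝ) (hT : ∀ ω, 0 < m ω → f ω ≤ T) :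
    ∃ (q : ℕ → Ω → ℝ) (t : ℕ → ℝ), (∀ k ω, 0 ≤ q k ω) ∧ (∀ k < n, ∑ ω, q k ω = 1) ∧
      (∀ ω, ∑ k ∈ Finset.range n, q k ω = m ω) ∧
      (∀ k < n, ∀ ω, 0 < q k ω → t k ≤ f ω ∧ f ω ≤ t (k + 1)) ∧ t n = T := by
  classical
  induction n generalizing m T with
  | zero =>
    refine ⟨fun _ _ => 0, fun _ => T, fun _ _ => le_rfl, by simp, fun ω => ?_, by simp, rfl⟩
    have h0 := (Finset.sum_eq_zero_iff_of_nonneg fun ω _ => hm ω).1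
      (by simpa using hmass) ω (Finset.mem_univ _)
    simp [h0]
  | succ n ih =>
    obtain ⟨q₁, t₁, hq0, hqm, hq1, hqt, hrt⟩ := exists_top_unit_mass m f hm (by
      rw [hmass]; push_cast; linarith [(Nat.cast_nonneg n : (0 : ℝ) ≤ n)])
    obtain ⟨q, t, h1, h2, h3, h4, h5⟩ := ih (fun ω => m ω - q₁ ω)
      (fun ω => sub_nonneg.2 (hqm ω))
      (by rw [Finset.sum_sub_distrib, hmass, hq1]; push_cast; ring) t₁
      (fun ω hω => hrt ω (sub_pos.1 hω))
    refine ⟨Function.update q n q₁, Function.update t (n + 1) T, ?_, ?_, ?_, ?_, ?_⟩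
    · intro k ω
      by_cases hk : k = n
      · subst hk; simpa using hq0 ω
      · simpa [hk] using h1 k ω
    · intro k hk
      by_cases hk' : k = n
      · subst hk'; simpa using hq1
      · simpa [hk'] using h2 k (by omega)
    · intro ω
      rw [Finset.sum_range_succ, Finset.sum_congr rfl (g := fun k => q k ω), h3]
      · simp
      · intro k hk
        rw [Function.update_of_ne (Finset.mem_range.1 hk).ne]
    · intro k hk ω hω
      by_cases hk' : k = n
      · subst hk'
        rw [Function.update_self] at hω
        rw [Function.update_self, Function.update_of_ne (by omega), h5]
        exact ⟨hqt ω hω, hT ω (hω.trans_le (hqm ω))⟩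
      · rw [Function.update_of_ne hk'] at hω
        rw [Function.update_of_ne (by omega), Function.update_of_ne (by omega)]
        exact h4 k (by omega) ω hω
    · simp

/-- Second moment of an affine sum of independent variables on a finite product space. -/
theorem sum_prod_mul_sq {Ω : Type*} [Fintype Ω] (n : ℕ) (q : ℕ → Ω → ℝ)
    (hq : ∀ k < n, ∑ ω, q k ω = 1) (X : Ω → ℝ) (c : ℝ) :
    ∑ s : Fin n → Ω, (∏ k : Fin n, q k (s k)) * (c + ∑ k, X (s k)) ^ 2 =
      (c + ∑ k ∈ Finset.range n, ∑ ω, q k ω * X ω) ^ 2 +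
        ∑ k ∈ Finset.range n, (∑ ω, q k ω * X ω ^ 2 - (∑ ω, q k ω * X ω) ^ 2) := by
  induction n generalizing q c with
  | zero => simp
  | succ n ih =>
    rw [← (Fin.consEquiv fun _ : Fin (n + 1) => Ω).sum_comp, Fintype.sum_prod_type]
    have hstep : ∀ ω : Ω, ∑ s : Fin n → Ω,
        (∏ k : Fin (n + 1), q k ((Fin.consEquiv fun _ : Fin (n + 1) => Ω) (ω, s) k)) *
          (c + ∑ k, X ((Fin.consEquiv fun _ : Fin (n + 1) => Ω) (ω, s) k)) ^ 2 =
        q 0 ω * ((c + X ω + ∑ k ∈ Finset.range n, ∑ ω, q (k + 1) ω * X ω) ^ 2 +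
        ∑ k ∈ Finset.range n, (∑ ω, q (k + 1) ω * X ω ^ 2 - (∑ ω, q (k + 1) ω * X ω) ^ 2)) := by
      intro ω
      rw [← ih (fun k => q (k + 1)) (fun k hk => hq (k + 1) (by omega)) (c + X ω),
        Finset.mul_sum]
      refine Finset.sum_congr rfl fun s _ => ?_
      rw [Fin.prod_univ_succ, Fin.sum_univ_succ]
      simp [Fin.consEquiv, mul_assoc, add_assoc]
    rw [Finset.sum_congr rfl fun ω _ => hstep ω, Finset.sum_range_succ', Finset.sum_range_succ']
    generalize ∑ k ∈ Finset.range n, ∑ ω, q (k + 1) ω * X ω = A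
    generalize ∑ k ∈ Finset.range n,
      (∑ ω, q (k + 1) ω * X ω ^ 2 - (∑ ω, q (k + 1) ω * X ω) ^ 2) = B
    have h0 := hq 0 (by omega)
    have hexp : ∀ ω, q 0 ω * ((c + X ω + A) ^ 2 + B) =
        q 0 ω * ((c + A) ^ 2 + B) + (q 0 ω * X ω) * (2 * (c + A)) + q 0 ω * X ω ^ 2 :=
      fun ω => by ring
    rw [Finset.sum_congr rfl fun ω _ => hexp ω, Finset.sum_add_distrib, Finset.sum_add_distrib,
      ← Finset.sum_mul, ← Finset.sum_mul, h0]
    ring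

theorem sum_prod_eq_one {Ω : Type*} [Fintype Ω] (n : ℕ) (q : ℕ → Ω → ℝ)
    (hq : ∀ k < n, ∑ ω, q k ω = 1) : ∑ s : Fin n → Ω, ∏ k : Fin n, q k (s k) = 1 := by
  simpa using sum_prod_mul_sq n q hq (fun _ => 0) 1

/-- Minkowski's inequality for second moments under finitely many nonnegative weights. -/
theorem sum_mul_sq_sum_le {S I : Type*} [Fintype S] (w : S → ℝ) (hw : ∀ s, 0 ≤ w s)
    (t : Finset I) (A : I → S → ℝ) (c : I → ℝ) (hc : ∀ i ∈ t, 0 ≤ c i)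
    (h : ∀ i ∈ t, ∑ s, w s * A i s ^ 2 ≤ c i ^ 2) :
    ∑ s, w s * (∑ i ∈ t, A i s) ^ 2 ≤ (∑ i ∈ t, c i) ^ 2 := by
  have hpair : ∀ i ∈ t, ∀ j ∈ t, ∑ s, w s * (A i s * A j s) ≤ c i * c j := by
    intro i hi j hj
    refine le_of_sq_le_sq ?_ (mul_nonneg (hc i hi) (hc j hj))
    have h1 := Finset.sum_mul_sq_le_sq_mul_sq Finset.univ
      (fun s => Real.sqrt (w s) * A i s) (fun s => Real.sqrt (w s) * A j s)
    have h2 : ∀ s, Real.sqrt (w s) * A i s * (Real.sqrt (w s) * A j s) =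
        w s * (A i s * A j s) := fun s => by
      linear_combination (A i s * A j s) * Real.mul_self_sqrt (hw s)
    have h3 : ∀ i s, (Real.sqrt (w s) * A i s) ^ 2 = w s * A i s ^ 2 := fun i s => by
      rw [mul_pow, Real.sq_sqrt (hw s)]
    simp only [h2, h3] at h1
    rw [mul_pow]
    exact h1.trans (mul_le_mul (h i hi) (h j hj)
      (Finset.sum_nonneg fun s _ => mul_nonneg (hw s) (sq_nonneg _)) (sq_nonneg _))
  calc ∑ s, w s * (∑ i ∈ t, A i s) ^ 2
      = ∑ i ∈ t, ∑ j ∈ t, ∑ s, w s * (A i s * A j s) := by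
        have hsq : ∀ s, w s * (∑ i ∈ t, A i s) ^ 2 =
            ∑ i ∈ t, ∑ j ∈ t, w s * (A i s * A j s) := fun s => by
          rw [sq, Finset.sum_mul_sum, Finset.mul_sum]
          exact Finset.sum_congr rfl fun i _ => Finset.mul_sum _ _ _
        rw [Finset.sum_congr rfl fun s _ => hsq s, Finset.sum_comm]
        exact Finset.sum_congr rfl fun i _ => Finset.sum_comm
    _ ≤ ∑ i ∈ t, ∑ j ∈ t, c i * c j :=
        Finset.sum_le_sum fun i hi => Finset.sum_le_sum fun j hj => hpair i hi j hj
    _ = (∑ i ∈ t, c i) ^ 2 := by rw [sq, Finset.sum_mul_sum]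

namespace RampNet

variable {L d_in : ℕ} {d : ℕ → ℕ}

/-- Input variation of single units, by distance to the input layer. -/
def unitIn (L : ℕ) (d : ℕ → ℕ) (W : ℕ → ℕ → ℕ → ℝ) : ℕ → ℕ → ℝ
  | 0 => fun _ => 1
  | t + 1 => fun j => ∑ i ∈ Finset.range (d (L - t)), W (L - (t + 1)) j i * unitIn L d W t i

theorem unitIn_sub {W : ℕ → ℕ → ℕ → ℝ} {ℓ : ℕ} (hℓ : ℓ < L) (j : ℕ) :
    unitIn L d W (L - ℓ) j =
      ∑ i ∈ Finset.range (d (ℓ + 1)), W ℓ j i * unitIn L d W (L - (ℓ + 1)) i := by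
  obtain ⟨t, rfl⟩ := Nat.exists_eq_add_of_lt hℓ
  have h1 : ℓ + t + 1 - ℓ = t + 1 := by omega
  have h2 : ℓ + t + 1 - (ℓ + 1) = t := by omega
  have h3 : ℓ + t + 1 - (t + 1) = ℓ := by omega
  have h4 : ℓ + t + 1 - t = ℓ + 1 := by omega
  rw [h1, h2, unitIn]
  simp only [h3, h4]

theorem zRev_sub {W : ℕ → ℕ → ℕ → ℝ} {x : ℕ → ℝ} {ℓ : ℕ} (hℓ : ℓ < L) (j : ℕ) :
    zRev L d_in d W x (L - ℓ) j = if j < d ℓ / 2 then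
      max (∑ i ∈ Finset.range (d (ℓ + 1)), W ℓ j i * zRev L d_in d W x (L - (ℓ + 1)) i) 0
    else -max (∑ i ∈ Finset.range (d (ℓ + 1)), W ℓ j i * zRev L d_in d W x (L - (ℓ + 1)) i) 0 := by
  obtain ⟨t, rfl⟩ := Nat.exists_eq_add_of_lt hℓ
  have h1 : ℓ + t + 1 - ℓ = t + 1 := by omega
  have h2 : ℓ + t + 1 - (ℓ + 1) = t := by omega
  have h3 : ℓ + t + 1 - (t + 1) = ℓ := by omega
  have h4 : ℓ + t + 1 - t = ℓ + 1 := by omega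
  rw [h1, h2, zRev]
  simp only [h3, h4]

theorem unitIn_nonneg {W : ℕ → ℕ → ℕ → ℝ} (hW : ∀ ℓ i j, 0 ≤ W ℓ i j) (t j : ℕ) :
    0 ≤ unitIn L d W t j := by
  induction t generalizing j with
  | zero => exact zero_le_one
  | succ t ih => exact Finset.sum_nonneg fun i _ => mul_nonneg (hW _ _ _) (ih i)

theorem measurable_zRev (W : ℕ → ℕ → ℕ → ℝ) (t j : ℕ) :
    Measurable fun x : ℕ → ℝ => zRev L d_in d W x t j := by
  induction t generalizing j with
  | zero =>
    simp only [zRev]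
    split_ifs
    · exact measurable_pi_apply _
    · exact (measurable_pi_apply _).neg
  | succ t ih =>
    have h : Measurable fun x : ℕ → ℝ => max (∑ i ∈ Finset.range (d (L - t)),
        W (L - (t + 1)) j i * zRev L d_in d W x t i) 0 :=
      (Finset.measurable_fun_sum _ fun i _ => (ih i).const_mul _).max measurable_const
    simp only [zRev]
    split_ifs
    · exact h
    · exact h.neg

theorem measurable_eval (net : RampNet L d_in d) : Measurable net.eval :=
  (Finset.measurable_fun_sum _ fun i _ => (measurable_zRev _ _ i).const_mul _).const_mul _

theorem abs_zRev_le {W : ℕ → ℕ → ℕ → ℝ} (hW : ∀ ℓ i j, 0 ≤ W ℓ i j) (hdL : d L = 2 * d_in)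
    {x : ℕ → ℝ} (hx : ∀ i < d_in, |x i| ≤ 1) {t : ℕ} (j : ℕ) (hj : j < d (L - t)) :
    |zRev L d_in d W x t j| ≤ unitIn L d W t j := by
  induction t generalizing j with
  | zero =>
    simp only [zRev, unitIn]
    rw [Nat.sub_zero, hdL] at hj
    split_ifs with h
    · exact hx j h
    · rw [abs_neg]
      exact hx _ (by omega)
  | succ t ih =>
    have h : |max (∑ i ∈ Finset.range (d (L - t)),
        W (L - (t + 1)) j i * zRev L d_in d W x t i) 0| ≤ unitIn L d W (t + 1) j := by
      have h1 := abs_max_sub_max_le_abs (∑ i ∈ Finset.range (d (L - t)),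
        W (L - (t + 1)) j i * zRev L d_in d W x t i) 0 0
      rw [max_self, sub_zero, sub_zero] at h1
      refine h1.trans ((Finset.abs_sum_le_sum_abs _ _).trans (Finset.sum_le_sum fun i hi => ?_))
      rw [abs_mul, abs_of_nonneg (hW _ _ _)]
      exact mul_le_mul_of_nonneg_left (ih i (Finset.mem_range.1 hi)) (hW _ _ _)
    simp only [zRev]
    split_ifs
    · exact h
    · rwa [abs_neg]

/-- Output variation of single units. -/
def unitOut (net : RampNet L d_in d) (ℓ j : ℕ) : ℝ := net.w0 * layerProd d net.W 0 ℓ 0 j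

theorem unitOut_nonneg (net : RampNet L d_in d) (ℓ j : ℕ) : 0 ≤ net.unitOut ℓ j :=
  mul_nonneg net.w0_nonneg (layerProd_nonneg d net.W_nonneg _ _ _ _)

theorem unitOut_succ (net : RampNet L d_in d) (ℓ k : ℕ) :
    net.unitOut (ℓ + 1) k = ∑ j ∈ Finset.range (d ℓ), net.unitOut ℓ j * net.W ℓ j k := by
  simp only [unitOut, layerProd, Finset.mul_sum, zero_add]
  exact Finset.sum_congr rfl fun j _ => by ring

theorem sum_layerProd_eq_unitIn {W : ℕ → ℕ → ℕ → ℝ} {ℓ : ℕ} (hℓ : ℓ ≤ L) {j : ℕ} (hj : j < d ℓ) :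
    ∑ k ∈ Finset.range (d L), layerProd d W ℓ (L - ℓ) j k = unitIn L d W (L - ℓ) j := by
  have h := layerProd_mulVec d W (fun ℓ => unitIn L d W (L - ℓ)) ℓ (L - ℓ)
    (fun ℓ' _ h₂ j _ => (unitIn_sub (by omega) j).symm) hj
  rw [Nat.add_sub_cancel' hℓ, Nat.sub_self] at h
  simpa [unitIn] using h

theorem Vin_eq (net : RampNet L d_in d) {ℓ : ℕ} (hℓ : ℓ ≤ L) :
    net.Vin ℓ = ∑ j ∈ Finset.range (d ℓ), unitIn L d net.W (L - ℓ) j := by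
  simp only [Vin, ell1]
  refine Finset.sum_congr rfl fun j hj => ?_
  rw [← sum_layerProd_eq_unitIn hℓ (Finset.mem_range.1 hj)]
  exact Finset.sum_congr rfl fun k _ =>
    abs_of_nonneg (layerProd_nonneg d net.W_nonneg _ _ _ _)

theorem Vout_eq (hd0 : d 0 = 1) (net : RampNet L d_in d) (ℓ : ℕ) :
    net.Vout ℓ = ∑ j ∈ Finset.range (d ℓ), net.unitOut ℓ j := by
  simp only [Vout, ell1, hd0, Finset.sum_range_one, Finset.mul_sum, unitOut,
    abs_of_nonneg (layerProd_nonneg d net.W_nonneg _ _ _ _)]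

theorem Vtot_eq (hd0 : d 0 = 1) (net : RampNet L d_in d) :
    net.Vtot = net.w0 * unitIn L d net.W L 0 := by
  have h := sum_layerProd_eq_unitIn (L := L) (d := d) (W := net.W) (ℓ := 0) (j := 0)
    (Nat.zero_le _) (by omega)
  rw [Nat.sub_zero] at h
  simp only [Vtot, ell1, hd0, Finset.sum_range_one,
    abs_of_nonneg (layerProd_nonneg d net.W_nonneg _ _ _ _), h]

/-- The variation splits over the units of any layer. -/
theorem sum_unitOut_mul_unitIn (hd0 : d 0 = 1) (net : RampNet L d_in d) {ℓ : ℕ} (hℓ : ℓ ≤ L) :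
    ∑ j ∈ Finset.range (d ℓ), net.unitOut ℓ j * unitIn L d net.W (L - ℓ) j = net.Vtot := by
  induction ℓ with
  | zero => simp [hd0, Vtot_eq hd0, unitOut, layerProd]
  | succ ℓ ih =>
    rw [← ih (by omega)]
    simp only [unitOut_succ, unitIn_sub (show ℓ < L by omega), Finset.sum_mul, Finset.mul_sum]
    rw [Finset.sum_comm]
    exact Finset.sum_congr rfl fun j _ => Finset.sum_congr rfl fun k _ => by ring

/-- Balancing the units layer by layer can only decrease the composite variation. -/
theorem balanced_le_compVar (hd0 : d 0 = 1) (net : RampNet L d_in d) :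
    (1 / (L : ℝ)) * (∑ ℓ ∈ Finset.range L, ∑ j ∈ Finset.range (d ℓ),
      Real.sqrt (net.unitOut ℓ j * unitIn L d net.W (L - ℓ) j)) * Real.sqrt net.Vtot ≤
      net.compVar := by
  refine mul_le_mul_of_nonneg_right (mul_le_mul_of_nonneg_left
    (Finset.sum_le_sum fun ℓ hℓ => ?_) (by positivity)) (Real.sqrt_nonneg _)
  rw [Vout_eq hd0, Vin_eq net (Finset.mem_range.1 hℓ).le, ← Finset.sum_add_distrib,
    Finset.sum_div]
  refine Finset.sum_le_sum fun j _ => ?_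
  have h1 := net.unitOut_nonneg ℓ j
  have h2 := unitIn_nonneg (L := L) (d := d) net.W_nonneg (L - ℓ) j
  refine Real.sqrt_le_iff.2 ⟨by positivity, ?_⟩
  nlinarith [sq_nonneg (net.unitOut ℓ j - unitIn L d net.W (L - ℓ) j)]

theorem Vtot_nonneg (net : RampNet L d_in d) : 0 ≤ net.Vtot :=
  mul_nonneg net.w0_nonneg
    (Finset.sum_nonneg fun _ _ => Finset.sum_nonneg fun _ _ => abs_nonneg _)

theorem abs_eval_le (hL : 1 ≤ L) (hd0 : d 0 = 1) (hdL : d L = 2 * d_in) (net : RampNet L d_in d)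
    {x : ℕ → ℝ} (hx : ∀ i < d_in, |x i| ≤ 1) : |net.eval x| ≤ net.Vtot := by
  have h := unitIn_sub (L := L) (d := d) (W := net.W) (ℓ := 0) (by omega) 0
  rw [Nat.sub_zero, zero_add] at h
  rw [eval, Vtot_eq hd0, h, abs_mul, abs_of_nonneg net.w0_nonneg]
  refine mul_le_mul_of_nonneg_left ?_ net.w0_nonneg
  refine (Finset.abs_sum_le_sum_abs _ _).trans (Finset.sum_le_sum fun i hi => ?_)
  rw [abs_mul, abs_of_nonneg (net.W_nonneg _ _ _)]
  refine mul_le_mul_of_nonneg_left (abs_zRev_le net.W_nonneg hdL hx i ?_) (net.W_nonneg _ _ _)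
  rw [Nat.sub_sub_self hL]
  exact Finset.mem_range.1 hi

end RampNet

/-- Normalized unit outputs attached to sampled paths `k : ι`, by distance to the input layer:
the paths sharing a label in a layer pass through the same unit, whose sign is the first
component of the label and which averages the outputs of its paths in the layer below. -/
def pathOutput {ι : Type*} [Fintype ι] (L : ℕ) (lab : ℕ → ι → Bool × ℕ) (y : ι → ℝ) :
    ℕ → ι → ℝ
  | 0 => y
  | t + 1 => fun k =>
      if (lab (L - (t + 1)) k).1 then
        max ((∑ k' with lab (L - (t + 1)) k' = lab (L - (t + 1)) k, pathOutput L lab y t k') /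
          (Finset.univ.filter fun k' => lab (L - (t + 1)) k' = lab (L - (t + 1)) k).card) 0
      else
        -max ((∑ k' with lab (L - (t + 1)) k' = lab (L - (t + 1)) k, pathOutput L lab y t k') /
          (Finset.univ.filter fun k' => lab (L - (t + 1)) k' = lab (L - (t + 1)) k).card) 0

section PathOutput

variable {ι : Type*} [Fintype ι] {L : ℕ}

theorem pathOutput_sub (lab : ℕ → ι → Bool × ℕ) (y : ι → ℝ) {ℓ : ℕ} (hℓ : ℓ < L) (k : ι) :
    pathOutput L lab y (L - ℓ) k = if (lab ℓ k).1 then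
        max ((∑ k' with lab ℓ k' = lab ℓ k, pathOutput L lab y (L - (ℓ + 1)) k') /
          (Finset.univ.filter fun k' => lab ℓ k' = lab ℓ k).card) 0
      else
        -max ((∑ k' with lab ℓ k' = lab ℓ k, pathOutput L lab y (L - (ℓ + 1)) k') /
          (Finset.univ.filter fun k' => lab ℓ k' = lab ℓ k).card) 0 := by
  obtain ⟨t, rfl⟩ := Nat.exists_eq_add_of_lt hℓ
  have h1 : ℓ + t + 1 - ℓ = t + 1 := by omega
  have h2 : ℓ + t + 1 - (ℓ + 1) = t := by omega
  have h3 : ℓ + t + 1 - (t + 1) = ℓ := by omega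
  rw [h1, h2, pathOutput]
  simp only [h3]

/-- Only the signs and the groupings of the labels matter. -/
theorem pathOutput_congr {lab lab' : ℕ → ι → Bool × ℕ} (y : ι → ℝ)
    (h1 : ∀ ℓ, 0 < ℓ → ℓ < L → ∀ k, (lab ℓ k).1 = (lab' ℓ k).1)
    (h2 : ∀ ℓ, 0 < ℓ → ℓ < L → ∀ k k', lab ℓ k = lab ℓ k' ↔ lab' ℓ k = lab' ℓ k')
    {t : ℕ} (ht : t < L) : pathOutput L lab y t = pathOutput L lab' y t := by
  induction t with
  | zero => rfl
  | succ t ih =>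
    funext k
    simp only [pathOutput]
    rw [ih (by omega), h1 _ (by omega) (by omega)]
    simp only [h2 (L - (t + 1)) (by omega) (by omega)]

/-- Reordering the sampled paths reorders their outputs. -/
theorem pathOutput_comp_perm (e : Equiv.Perm ι) (lab : ℕ → ι → Bool × ℕ) (y : ι → ℝ) (t : ℕ)
    (k : ι) :
    pathOutput L (fun ℓ k => lab ℓ (e k)) (fun k => y (e k)) t k = pathOutput L lab y t (e k) := by
  induction t generalizing k with
  | zero => rfl
  | succ t ih =>
    simp only [pathOutput, ih]
    have hs : ∀ (a : Bool × ℕ), ∑ k' with lab (L - (t + 1)) (e k') = a,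
        pathOutput L lab y t (e k') = ∑ k' with lab (L - (t + 1)) k' = a,
        pathOutput L lab y t k' := fun a => by
      rw [Finset.sum_filter, Finset.sum_filter]
      exact Equiv.sum_comp e fun k' => if lab (L - (t + 1)) k' = a then pathOutput L lab y t k' else 0
    have hc : ∀ (a : Bool × ℕ), (Finset.univ.filter fun k' => lab (L - (t + 1)) (e k') = a).card =
        (Finset.univ.filter fun k' => lab (L - (t + 1)) k' = a).card := fun a => by
      simp only [Finset.card_filter]
      exact Equiv.sum_comp e fun k' => if lab (L - (t + 1)) k' = a then 1 else 0
    rw [hs, hc]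

/-- The deviation of sampled outputs from unit outputs is controlled by the deviations of the
group sums, layer by layer. -/
theorem sum_abs_pathOutput_sub_le (d : ℕ → ℕ) (pos : ℕ → ℕ → Bool) (J : ℕ → ι → ℕ)
    (hJ : ∀ ℓ < L, ∀ k, J ℓ k < d ℓ) (g m : ℕ → ℕ → ℝ)
    (hg : ∀ ℓ, 0 < ℓ → ℓ < L → ∀ k, g ℓ (J ℓ k) =
      if pos ℓ (J ℓ k) then max (m ℓ (J ℓ k)) 0 else -max (m ℓ (J ℓ k)) 0)
    {ℓ : ℕ} (h0 : 0 < ℓ) (hℓ : ℓ ≤ L) :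
    ∑ k, |pathOutput L (fun ℓ k => (pos ℓ (J ℓ k), J ℓ k)) (fun k => g L (J L k)) (L - ℓ) k -
      g ℓ (J ℓ k)| ≤ ∑ ℓ' ∈ Finset.Ico ℓ L, ∑ j ∈ Finset.range (d ℓ'),
        |∑ k with J ℓ' k = j, (g (ℓ' + 1) (J (ℓ' + 1) k) - m ℓ' j)| := by
  induction hℓ using Nat.decreasingInduction with
  | self => simp [pathOutput]
  | of_succ ℓ hℓ ih =>
    have hlt : ℓ < L := hℓ
    rw [Finset.sum_eq_sum_Ico_succ_bot hlt]
    refine le_trans ?_ (add_le_add_right (ih (Nat.succ_pos _)) _)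
    set Y := pathOutput L (fun ℓ k => (pos ℓ (J ℓ k), J ℓ k)) (fun k => g L (J L k)) with hY
    have hlab : ∀ k k', ((pos ℓ (J ℓ k'), J ℓ k') = (pos ℓ (J ℓ k), J ℓ k)) ↔ J ℓ k' = J ℓ k := by
      intro k k'
      constructor
      · intro h
        exact (Prod.mk.inj h).2
      · intro h
        rw [h]
    have hstep : ∀ k, |Y (L - ℓ) k - g ℓ (J ℓ k)| ≤
        |(∑ k' with J ℓ k' = J ℓ k, Y (L - (ℓ + 1)) k') /
          (Finset.univ.filter fun k' => J ℓ k' = J ℓ k).card - m ℓ (J ℓ k)| := by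
      intro k
      have h1 := pathOutput_sub (fun ℓ k => (pos ℓ (J ℓ k), J ℓ k)) (fun k => g L (J L k)) hlt k
      simp only [hlab] at h1
      rw [← hY] at h1
      rw [h1, hg ℓ h0 hlt]
      refine le_trans ?_ (abs_max_sub_max_le_abs _ _ 0)
      split_ifs
      · exact le_rfl
      · rw [neg_sub_neg, abs_sub_comm]
    refine (Finset.sum_le_sum fun k _ => hstep k).trans ?_
    rw [← Finset.sum_fiberwise_of_maps_to (s := Finset.univ) (t := Finset.range (d ℓ))
      (g := J ℓ) (fun k _ => Finset.mem_range.2 (hJ ℓ hlt k))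
      (f := fun k => |Y (L - (ℓ + 1)) k - g (ℓ + 1) (J (ℓ + 1) k)|),
      ← Finset.sum_fiberwise_of_maps_to (s := Finset.univ) (t := Finset.range (d ℓ))
      (g := J ℓ) (fun k _ => Finset.mem_range.2 (hJ ℓ hlt k)), ← Finset.sum_add_distrib]
    refine Finset.sum_le_sum fun j _ => ?_
    set G := Finset.univ.filter fun k => J ℓ k = j with hG
    have h1 : ∑ k ∈ G, |(∑ k' with J ℓ k' = J ℓ k, Y (L - (ℓ + 1)) k') /
          (Finset.univ.filter fun k' => J ℓ k' = J ℓ k).card - m ℓ (J ℓ k)| =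
        ∑ k ∈ G, |(∑ k' ∈ G, Y (L - (ℓ + 1)) k') / G.card - m ℓ j| := by
      refine Finset.sum_congr rfl fun k hk => ?_
      rw [(Finset.mem_filter.1 hk).2]
    have h2 : ∑ k ∈ G, |(∑ k' ∈ G, Y (L - (ℓ + 1)) k') / G.card - m ℓ j| =
        |∑ k ∈ G, (Y (L - (ℓ + 1)) k - m ℓ j)| := by
      rw [Finset.sum_const, nsmul_eq_mul, Finset.sum_sub_distrib, Finset.sum_const, nsmul_eq_mul]
      rcases G.eq_empty_or_nonempty with h | h
      · simp [h]
      · have hpos : (0 : ℝ) < G.card := by exact_mod_cast h.card_pos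
        rw [← abs_of_pos hpos, ← abs_mul, abs_of_pos hpos, mul_sub, mul_div_cancel₀ _ hpos.ne']
    have h3 : ∑ k ∈ G, (Y (L - (ℓ + 1)) k - m ℓ j) =
        ∑ k ∈ G, (g (ℓ + 1) (J (ℓ + 1) k) - m ℓ j) +
          ∑ k ∈ G, (Y (L - (ℓ + 1)) k - g (ℓ + 1) (J (ℓ + 1) k)) := by
      rw [← Finset.sum_add_distrib]
      exact Finset.sum_congr rfl fun k _ => by ring
    rw [h1, h2, h3]
    exact (abs_add_le _ _).trans (add_le_add_right (Finset.abs_sum_le_sum_abs _ _) _)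

end PathOutput

section SampledNet

variable {ι : Type*} [Fintype ι] {L d_in : ℕ} {d : ℕ → ℕ}

/-- Number of sampled paths through unit `j` of layer `ℓ`. -/
def groupCard (J : ℕ → ι → ℕ) (ℓ j : ℕ) : ℝ := (Finset.univ.filter fun k => J ℓ k = j).card

/-- The balanced network whose path weights are `α` times the path counts of a sample. -/
def sampledNet (L d_in : ℕ) (d : ℕ → ℕ) (α : ℝ) (J : ℕ → ι → ℕ) : RampNet L d_in d where
  w0 := Real.sqrt α * Real.sqrt (Fintype.card ι)
  W ℓ i j := ((Finset.univ.filter fun k => J ℓ k = i ∧ J (ℓ + 1) k = j).card : ℝ) /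
    Real.sqrt (groupCard J ℓ i) *
      if ℓ + 1 = L then Real.sqrt α else (Real.sqrt (groupCard J (ℓ + 1) j))⁻¹
  w0_nonneg := by positivity
  W_nonneg ℓ i j := by split_ifs <;> positivity

/-- Variation of the units of `sampledNet`. -/
def sampledVar (L : ℕ) (α : ℝ) (J : ℕ → ι → ℕ) (ℓ j : ℕ) : ℝ :=
  if ℓ = L then 1 else Real.sqrt α * Real.sqrt (groupCard J ℓ j)

theorem groupCard_pos (J : ℕ → ι → ℕ) (ℓ : ℕ) (k : ι) : 0 < groupCard J ℓ (J ℓ k) := by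
  unfold groupCard
  exact_mod_cast Finset.card_pos.2 ⟨k, by simp⟩

theorem groupCard_nonneg (J : ℕ → ι → ℕ) (ℓ j : ℕ) : 0 ≤ groupCard J ℓ j := Nat.cast_nonneg _

theorem sum_sampledNet_W_mul (α : ℝ) (J : ℕ → ι → ℕ) {ℓ : ℕ}
    (hJ : ∀ k, J (ℓ + 1) k < d (ℓ + 1)) (z : ℕ → ℝ) (c : ι → ℝ)
    (hz : ∀ k, z (J (ℓ + 1) k) = sampledVar L α J (ℓ + 1) (J (ℓ + 1) k) * c k) (j : ℕ) :
    ∑ i ∈ Finset.range (d (ℓ + 1)), (sampledNet L d_in d α J).W ℓ j i * z i =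
      Real.sqrt α / Real.sqrt (groupCard J ℓ j) * ∑ k with J ℓ k = j, c k := by
  have h1 : ∀ k, (if ℓ + 1 = L then Real.sqrt α
      else (Real.sqrt (groupCard J (ℓ + 1) (J (ℓ + 1) k)))⁻¹) * z (J (ℓ + 1) k) =
      Real.sqrt α * c k := by
    intro k
    have hpos := Real.sqrt_pos.2 (groupCard_pos J (ℓ + 1) k)
    rw [hz k, sampledVar]
    split_ifs
    · ring
    · field_simp
  rw [Finset.mul_sum]
  have h2 : ∀ k, Real.sqrt α / Real.sqrt (groupCard J ℓ j) * c k =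
      (Real.sqrt (groupCard J ℓ j))⁻¹ * ((if ℓ + 1 = L then Real.sqrt α
      else (Real.sqrt (groupCard J (ℓ + 1) (J (ℓ + 1) k)))⁻¹) * z (J (ℓ + 1) k)) := by
    intro k
    rw [h1 k]
    ring
  simp only [h2]
  rw [← Finset.sum_fiberwise_of_maps_to (t := Finset.range (d (ℓ + 1))) (g := J (ℓ + 1))
    fun k _ => Finset.mem_range.2 (hJ k)]
  refine Finset.sum_congr rfl fun i _ => ?_
  rw [Finset.filter_filter]
  simp only [sampledNet]
  have h3 : ∀ k ∈ Finset.univ.filter fun k => J ℓ k = j ∧ J (ℓ + 1) k = i,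
      (Real.sqrt (groupCard J ℓ j))⁻¹ * ((if ℓ + 1 = L then Real.sqrt α
      else (Real.sqrt (groupCard J (ℓ + 1) (J (ℓ + 1) k)))⁻¹) * z (J (ℓ + 1) k)) =
      (Real.sqrt (groupCard J ℓ j))⁻¹ * ((if ℓ + 1 = L then Real.sqrt α
      else (Real.sqrt (groupCard J (ℓ + 1) i))⁻¹) * z i) := by
    intro k hk
    rw [(Finset.mem_filter.1 hk).2.2]
  rw [Finset.sum_congr rfl h3, Finset.sum_const, nsmul_eq_mul]
  ring

theorem sum_sampledNet_W_mul_sampledVar (α : ℝ) (J : ℕ → ι → ℕ) {ℓ : ℕ} (hℓ : ℓ < L)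
    (hJ : ∀ k, J (ℓ + 1) k < d (ℓ + 1)) (j : ℕ) :
    ∑ i ∈ Finset.range (d (ℓ + 1)), (sampledNet L d_in d α J).W ℓ j i * sampledVar L α J (ℓ + 1) i =
      sampledVar L α J ℓ j := by
  rw [sum_sampledNet_W_mul α J hJ _ (fun _ => 1) (fun k => (mul_one _).symm), sampledVar,
    if_neg hℓ.ne, Finset.sum_const, nsmul_eq_mul, mul_one, div_mul_eq_mul_div, mul_div_assoc]
  exact congrArg _ Real.div_sqrt

theorem unitIn_sampledNet (α : ℝ) (J : ℕ → ι → ℕ) (hJ : ∀ ℓ ≤ L, ∀ k, J ℓ k < d ℓ) {ℓ : ℕ}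
    (hℓ : ℓ ≤ L) (j : ℕ) :
    RampNet.unitIn L d (sampledNet L d_in d α J).W (L - ℓ) j = sampledVar L α J ℓ j := by
  induction hℓ using Nat.decreasingInduction generalizing j with
  | self => simp [RampNet.unitIn, sampledVar]
  | of_succ ℓ hℓ ih =>
    rw [RampNet.unitIn_sub hℓ, ← sum_sampledNet_W_mul_sampledVar (d := d) (d_in := d_in) α J hℓ
      (hJ _ hℓ)]
    exact Finset.sum_congr rfl fun i _ => by rw [ih]

theorem groupCard_zero (hd0 : d 0 = 1) (J : ℕ → ι → ℕ) (hJ : ∀ k, J 0 k < d 0) :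
    groupCard J 0 0 = Fintype.card ι := by
  unfold groupCard
  rw [Finset.filter_true_of_mem fun k _ => by have := hJ k; omega, Finset.card_univ]

theorem unitOut_sampledNet (hd0 : d 0 = 1) (α : ℝ) (J : ℕ → ι → ℕ)
    (hJ : ∀ ℓ ≤ L, ∀ k, J ℓ k < d ℓ) {ℓ : ℕ} (hℓ : ℓ < L) {j : ℕ} (hj : j < d ℓ) :
    (sampledNet L d_in d α J).unitOut ℓ j = sampledVar L α J ℓ j := by
  induction ℓ generalizing j with
  | zero =>
    obtain rfl : j = 0 := by omega
    rw [sampledVar, if_neg hℓ.ne, groupCard_zero hd0 J (hJ 0 (Nat.zero_le _))]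
    simp [RampNet.unitOut, layerProd, sampledNet]
  | succ ℓ ih =>
    rw [RampNet.unitOut_succ, Finset.sum_congr rfl fun i hi => by
      rw [ih (by omega) (Finset.mem_range.1 hi)]]
    have hterm : ∀ i, sampledVar L α J ℓ i * (sampledNet L d_in d α J).W ℓ i j =
        Real.sqrt α * (Real.sqrt (groupCard J (ℓ + 1) j))⁻¹ *
          ((Finset.univ.filter fun k => J ℓ k = i ∧ J (ℓ + 1) k = j).card : ℝ) := by
      intro i
      simp only [sampledVar, sampledNet, if_neg hℓ.ne, if_neg (show ℓ ≠ L by omega)]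
      rcases (groupCard_nonneg J ℓ i).eq_or_lt with h | h
      · have h' : (Finset.univ.filter fun k => J ℓ k = i ∧ J (ℓ + 1) k = j).card = 0 := by
          have h2 : (Finset.univ.filter fun k => J ℓ k = i).card = 0 := by
            unfold groupCard at h
            exact_mod_cast h.symm
          refine Nat.eq_zero_of_le_zero (h2 ▸ Finset.card_le_card fun k hk => ?_)
          simp only [Finset.mem_filter] at hk ⊢
          exact ⟨hk.1, hk.2.1⟩
        rw [h']
        simp
      · have hpos := Real.sqrt_pos.2 h
        field_simp
    simp only [hterm]
    rw [← Finset.mul_sum, sampledVar, if_neg hℓ.ne]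
    have hsum : ∑ i ∈ Finset.range (d ℓ),
        ((Finset.univ.filter fun k => J ℓ k = i ∧ J (ℓ + 1) k = j).card : ℝ) =
        groupCard J (ℓ + 1) j := by
      unfold groupCard
      rw [Finset.card_eq_sum_card_fiberwise (f := J ℓ) (t := Finset.range (d ℓ))
        fun k _ => by simpa using hJ ℓ (by omega) k]
      push_cast
      refine Finset.sum_congr rfl fun i _ => ?_
      rw [Finset.filter_filter]
      simp only [and_comm]
    rw [hsum, mul_assoc, ← div_eq_inv_mul, Real.div_sqrt]

theorem compVar_sampledNet (hL : 0 < L) (hd0 : d 0 = 1) {α : ℝ} (hα : 0 ≤ α) (J : ℕ → ι → ℕ)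
    (hJ : ∀ ℓ ≤ L, ∀ k, J ℓ k < d ℓ) :
    (sampledNet L d_in d α J).compVar = α / L * Real.sqrt (Fintype.card ι) *
      ∑ ℓ ∈ Finset.range L, ∑ j ∈ Finset.range (d ℓ), Real.sqrt (groupCard J ℓ j) := by
  have htot : (sampledNet L d_in d α J).Vtot = (Real.sqrt α * Real.sqrt (Fintype.card ι)) ^ 2 := by
    have h := unitIn_sampledNet (d_in := d_in) α J hJ (Nat.zero_le L) 0
    rw [Nat.sub_zero] at h
    rw [RampNet.Vtot_eq hd0, h, sampledVar, if_neg hL.ne,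
      groupCard_zero hd0 J (hJ 0 (Nat.zero_le _)), sq]
    rfl
  have hbar : (sampledNet L d_in d α J).Vbar = 1 / (L : ℝ) * ∑ ℓ ∈ Finset.range L,
      ∑ j ∈ Finset.range (d ℓ), Real.sqrt α * Real.sqrt (groupCard J ℓ j) := by
    rw [RampNet.Vbar]
    congr 1
    refine Finset.sum_congr rfl fun ℓ hℓ => ?_
    have hℓ' := Finset.mem_range.1 hℓ
    rw [RampNet.Vout_eq hd0, RampNet.Vin_eq _ hℓ'.le, ← Finset.sum_add_distrib, Finset.sum_div]
    refine Finset.sum_congr rfl fun j hj => ?_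
    rw [unitIn_sampledNet α J hJ hℓ'.le, unitOut_sampledNet hd0 α J hJ hℓ' (Finset.mem_range.1 hj),
      sampledVar, if_neg hℓ'.ne]
    ring
  rw [RampNet.compVar, htot, hbar, Real.sqrt_sq (by positivity)]
  simp only [← Finset.mul_sum]
  linear_combination (1 / (L : ℝ) * Real.sqrt (Fintype.card ι) *
    ∑ ℓ ∈ Finset.range L, ∑ j ∈ Finset.range (d ℓ), Real.sqrt (groupCard J ℓ j)) *
    Real.mul_self_sqrt hα

/-- Coordinates of the doubled input. -/
def doubledInput (d_in : ℕ) (x : ℕ → ℝ) (j : ℕ) : ℝ := if j < d_in then x j else -x (j - d_in)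

theorem zRev_sampledNet (α : ℝ) (J : ℕ → ι → ℕ) (hJ : ∀ ℓ ≤ L, ∀ k, J ℓ k < d ℓ) (x : ℕ → ℝ)
    {ℓ : ℕ} (hℓ : ℓ ≤ L) (k : ι) :
    RampNet.zRev L d_in d (sampledNet L d_in d α J).W x (L - ℓ) (J ℓ k) =
      sampledVar L α J ℓ (J ℓ k) *
        pathOutput L (fun ℓ k => (decide (J ℓ k < d ℓ / 2), J ℓ k))
          (fun k => doubledInput d_in x (J L k)) (L - ℓ) k := by
  induction hℓ using Nat.decreasingInduction generalizing k with
  | self => simp [RampNet.zRev, sampledVar, pathOutput, doubledInput]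
  | of_succ ℓ hℓ ih =>
    have hlt : ℓ < L := hℓ
    have hlab : ∀ k k', ((decide (J ℓ k' < d ℓ / 2), J ℓ k') =
        (decide (J ℓ k < d ℓ / 2), J ℓ k)) ↔ J ℓ k' = J ℓ k := by
      intro k k'
      constructor
      · intro h
        exact (Prod.mk.inj h).2
      · intro h
        rw [h]
    rw [RampNet.zRev_sub hlt, pathOutput_sub _ _ hlt,
      sum_sampledNet_W_mul α J (hJ _ hℓ) _ _ ih]
    simp only [hlab, decide_eq_true_eq]
    have hpos := groupCard_pos J ℓ k
    have hsqrt := Real.sqrt_pos.2 hpos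
    have hmax : ∀ S : ℝ, max (Real.sqrt α / Real.sqrt (groupCard J ℓ (J ℓ k)) * S) 0 =
        sampledVar L α J ℓ (J ℓ k) * max (S / groupCard J ℓ (J ℓ k)) 0 := by
      intro S
      rw [sampledVar, if_neg hlt.ne, mul_max_of_nonneg _ _ (by positivity), mul_zero]
      congr 1
      have hsq := Real.mul_self_sqrt hpos.le
      field_simp
      linear_combination (-(Real.sqrt α * S)) * hsq
    rw [hmax]
    unfold groupCard
    split_ifs <;> ring

theorem eval_sampledNet (hL : 0 < L) (hd0 : d 0 = 1) {α : ℝ} (hα : 0 ≤ α) (J : ℕ → ι → ℕ)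
    (hJ : ∀ ℓ ≤ L, ∀ k, J ℓ k < d ℓ) (x : ℕ → ℝ) :
    (sampledNet L d_in d α J).eval x =
      α * ∑ k, pathOutput L (fun ℓ k => (decide (J ℓ k < d ℓ / 2), J ℓ k))
          (fun k => doubledInput d_in x (J L k)) (L - 1) k := by
  have h := sum_sampledNet_W_mul (L := L) (d_in := d_in) (d := d) α J (ℓ := 0) (hJ 1 hL) _ _
    (zRev_sampledNet (d_in := d_in) α J hJ x (ℓ := 1) hL) 0
  rw [RampNet.eval]
  rw [zero_add] at h
  rw [h, Finset.filter_true_of_mem fun k _ => by have := hJ 0 (Nat.zero_le _) k; omega,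
    groupCard_zero hd0 J (hJ 0 (Nat.zero_le _))]
  simp only [sampledNet]
  rcases isEmpty_or_nonempty ι with hι | hι
  · simp
  · have hpos : 0 < Real.sqrt (Fintype.card ι) :=
      Real.sqrt_pos.2 (by exact_mod_cast Fintype.card_pos)
    have hsq := Real.mul_self_sqrt hα
    field_simp
    rw [sq, hsq, mul_comm]

end SampledNet

section Coding

/-- Code of `n` sampled paths sorted by their units in layer `1`. For layer `1` it records, per
path, the sign of its unit and whether the unit differs from that of the preceding path. -/
abbrev PathCode (L d_in : ℕ) (d : ℕ → ℕ) (M n : ℕ) : Type :=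
  (Fin n → Bool × Bool) × ((t : Fin (L - 2)) → Fin n → Fin (min (d (t + 2)) (2 * M))) ×
    (Fin n → Fin (2 * d_in))

/-- Unit labels described by a code. -/
def decodeLabel {L d_in : ℕ} {d : ℕ → ℕ} {M n : ℕ} (c : PathCode L d_in d M n) (ℓ : ℕ)
    (k : Fin n) : Bool × ℕ :=
  if ℓ = 1 then ((c.1 k).1, (Finset.univ.filter fun i => i ≤ k ∧ (c.1 i).2 = true).card)
  else if h : ℓ - 2 < L - 2 then
    (decide ((c.2.1 ⟨ℓ - 2, h⟩ k : ℕ) < min (d (ℓ - 2 + 2)) (2 * M) / 2), c.2.1 ⟨ℓ - 2, h⟩ k)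
  else (false, 0)

theorem exists_sign_newbit {n : ℕ} (a : Fin n → ℕ) (ha : Monotone a) (sgn : ℕ → Bool) :
    ∃ b : Fin n → Bool × Bool, (∀ k, (b k).1 = sgn (a k)) ∧ ∀ k k',
      a k = a k' ↔ ((b k).1, (Finset.univ.filter fun i => i ≤ k ∧ (b i).2 = true).card) =
        ((b k').1, (Finset.univ.filter fun i => i ≤ k' ∧ (b i).2 = true).card) := by
  classical
  refine ⟨fun k => (sgn (a k), decide (∀ i < k, a i ≠ a k)), fun k => rfl, ?_⟩
  simp only [decide_eq_true_eq]
  have heq : ∀ k k', k ≤ k' → a k = a k' →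
      (Finset.univ.filter fun i => i ≤ k ∧ ∀ i' < i, a i' ≠ a i) =
      (Finset.univ.filter fun i => i ≤ k' ∧ ∀ i' < i, a i' ≠ a i) := by
    intro k k' hk h
    ext i
    simp only [Finset.mem_filter, Finset.mem_univ, true_and]
    refine ⟨fun hi => ⟨hi.1.trans hk, hi.2⟩, fun hi => ⟨?_, hi.2⟩⟩
    by_contra! hlt
    exact hi.2 k hlt (le_antisymm (ha hlt.le) (h ▸ ha hi.1))
  have hlt : ∀ k k', a k < a k' →
      (Finset.univ.filter fun i => i ≤ k ∧ ∀ i' < i, a i' ≠ a i).card <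
      (Finset.univ.filter fun i => i ≤ k' ∧ ∀ i' < i, a i' ≠ a i).card := by
    intro k k' h
    have hk : k < k' := ha.reflect_lt h
    obtain ⟨i, hi, hmin⟩ := Finset.exists_min_image (Finset.univ.filter fun i => a i = a k') id
      ⟨k', by simp⟩
    simp only [Finset.mem_filter, Finset.mem_univ, true_and, id] at hi hmin
    refine Finset.card_lt_card (Finset.ssubset_iff_of_subset (fun i' hi' => ?_) |>.2 ⟨i, ?_, ?_⟩)
    · simp only [Finset.mem_filter, Finset.mem_univ, true_and] at hi' ⊢
      exact ⟨hi'.1.trans hk.le, hi'.2⟩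
    · simp only [Finset.mem_filter, Finset.mem_univ, true_and]
      exact ⟨hmin k' rfl, fun i' hi' he => absurd (hmin i' (he.trans hi)) (not_le.2 hi')⟩
    · simp only [Finset.mem_filter, Finset.mem_univ, true_and, not_and]
      intro hik
      exact absurd (hi ▸ ha hik) (not_le.2 h)
  intro k k'
  constructor
  · intro h
    rcases le_total k k' with hk | hk
    · rw [heq k k' hk h, h]
    · rw [heq k' k hk h.symm, h]
  · intro h
    have hcard := (Prod.mk.inj h).2
    rcases lt_trichotomy (a k) (a k') with h1 | h1 | h1
    · exact absurd hcard (hlt _ _ h1).ne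
    · exact h1
    · exact absurd hcard (hlt _ _ h1).ne'

theorem exists_short_label {n M D : ℕ} (hn : n ≤ M) (a : Fin n → ℕ) (ha : ∀ k, a k < D) :
    ∃ b : Fin n → Fin (min D (2 * M)),
      (∀ k, (b k : ℕ) < min D (2 * M) / 2 ↔ a k < D / 2) ∧
        ∀ k k', a k = a k' ↔ (b k : ℕ) = b k' := by
  rcases le_or_gt D (2 * M) with h | h
  · refine ⟨fun k => ⟨a k, by rw [min_eq_left h]; exact ha k⟩, fun k => ?_, fun k k' => Iff.rfl⟩
    simp only [min_eq_left h]
  · rcases Nat.eq_zero_or_pos n with rfl | hpos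
    · exact ⟨fun k => k.elim0, fun k => k.elim0, fun k => k.elim0⟩
    have : Nonempty (Fin n) := ⟨⟨0, hpos⟩⟩
    have hinv : ∀ k : Fin n, a (Function.invFun a (a k)) = a k := fun k => Function.invFun_eq ⟨k, rfl⟩
    refine ⟨fun k => ⟨if a k < D / 2 then (Function.invFun a (a k)).val else M + (Function.invFun a (a k)).val,
      ?_⟩, fun k => ?_, fun k k' => ?_⟩
    · have := (Function.invFun a (a k)).2
      split_ifs <;> omega
    · have := (Function.invFun a (a k)).2
      dsimp only
      split_ifs <;> omega
    · constructor
      · intro hk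
        dsimp only
        rw [hk]
      · intro hk
        have h1 := (Function.invFun a (a k)).2
        have h2 := (Function.invFun a (a k')).2
        have h3 : Function.invFun a (a k) = Function.invFun a (a k') := by
          dsimp only at hk
          apply Fin.ext
          split_ifs at hk <;> omega
        rw [← hinv k, h3, hinv]

/-- The outputs of any sample of `n ≤ M` paths are described by a code. -/
theorem exists_pathCode {L d_in : ℕ} {d : ℕ → ℕ} {M n : ℕ} (hdL : d L = 2 * d_in) (hn : n ≤ M)
    (hL : 0 < L) (J : ℕ → Fin n → ℕ) (hJ : ∀ ℓ ≤ L, ∀ k, J ℓ k < d ℓ) :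
    ∃ c : PathCode L d_in d M n, ∀ y : ℕ → ℝ,
      ∑ k, pathOutput L (fun ℓ k => (decide (J ℓ k < d ℓ / 2), J ℓ k)) (fun k => y (J L k))
        (L - 1) k =
      ∑ k, pathOutput L (decodeLabel c) (fun k => y (c.2.2 k)) (L - 1) k := by
  set e := Tuple.sort (J 1) with he
  obtain ⟨b, hb1, hb2⟩ := exists_sign_newbit (J 1 ∘ e) (Tuple.monotone_sort (J 1))
    fun j => decide (j < d 1 / 2)
  have hlab : ∀ t : Fin (L - 2), ∃ b : Fin n → Fin (min (d (t + 2)) (2 * M)),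
      (∀ k, (b k : ℕ) < min (d (t + 2)) (2 * M) / 2 ↔ J (t + 2) (e k) < d (t + 2) / 2) ∧
        ∀ k k', J (t + 2) (e k) = J (t + 2) (e k') ↔ (b k : ℕ) = b k' :=
    fun t => exists_short_label hn (fun k => J (t + 2) (e k)) fun k => hJ _ (by omega) _
  choose u hu1 hu2 using hlab
  refine ⟨(b, u, fun k => ⟨J L (e k), hdL ▸ hJ L le_rfl _⟩), fun y => ?_⟩
  rw [← Equiv.sum_comp e]
  refine Finset.sum_congr rfl fun k _ => ?_
  rw [← pathOutput_comp_perm e]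
  refine congrFun (pathOutput_congr _ (fun ℓ h0 hℓ k => ?_) (fun ℓ h0 hℓ k k' => ?_)
    (by omega)) k
  · rcases (show ℓ = 1 ∨ 2 ≤ ℓ by omega) with rfl | h2
    · simp [decodeLabel, hb1]
    · obtain ⟨t, rfl⟩ := Nat.exists_eq_add_of_le' h2
      have ht : t < L - 2 := by omega
      have := hu1 ⟨t, ht⟩ k
      simp only [decodeLabel, show t + 2 ≠ 1 by omega, if_false, Nat.add_sub_cancel, ht, dif_pos]
      exact decide_eq_decide.2 this.symm
  · have hsplit : ∀ k k', ((decide (J ℓ (e k) < d ℓ / 2), J ℓ (e k)) =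
        (decide (J ℓ (e k') < d ℓ / 2), J ℓ (e k'))) ↔ J ℓ (e k) = J ℓ (e k') :=
      fun k k' => ⟨fun h => (Prod.mk.inj h).2, fun h => by rw [h]⟩
    rw [hsplit]
    rcases (show ℓ = 1 ∨ 2 ≤ ℓ by omega) with rfl | h2
    · simpa [decodeLabel] using hb2 k k'
    · obtain ⟨t, rfl⟩ := Nat.exists_eq_add_of_le' h2
      have ht : t < L - 2 := by omega
      have := hu2 ⟨t, ht⟩ k k'
      simp only [decodeLabel, show t + 2 ≠ 1 by omega, if_false, Nat.add_sub_cancel, ht, dif_pos]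
      exact this.trans ⟨fun h => Prod.ext (congrArg (fun i => decide (i < _)) h) h, fun h => (Prod.mk.inj h).2⟩

theorem prod_min_le_min_dbar_pow {L : ℕ} {d : ℕ → ℕ} (hL : 2 ≤ L) (a : ℝ) (ha : 0 ≤ a) :
    ∏ t : Fin (L - 2), min (d (t + 2) : ℝ) a ≤ min (dbar L d) a ^ (L - 2) := by
  have hprod : ∏ t : Fin (L - 2), (d (t + 2) : ℝ) = ∏ ℓ ∈ Finset.Icc 2 (L - 1), (d ℓ : ℝ) := by
    rw [Fin.prod_univ_eq_prod_range fun t => (d (t + 2) : ℝ), Finset.range_eq_Ico,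
      Finset.prod_Ico_add' (fun t => (d t : ℝ)) 0 (L - 2) 2]
    congr 1
  have h0 : ∀ t ∈ (Finset.univ : Finset (Fin (L - 2))), 0 ≤ min (d (t + 2) : ℝ) a :=
    fun t _ => le_min (Nat.cast_nonneg _) ha
  have hdbar : dbar L d ^ (L - 2) = ∏ t : Fin (L - 2), (d (t + 2) : ℝ) := by
    rcases hL.eq_or_lt with rfl | hlt
    · simp
    · rw [hprod, dbar, ← Real.rpow_natCast, ← Real.rpow_mul (by positivity), Nat.cast_sub hL,
        Nat.cast_ofNat, inv_mul_cancel₀, Real.rpow_one]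
      have : (2 : ℝ) < L := by exact_mod_cast hlt
      linarith
  rcases min_cases (dbar L d) a with ⟨h, -⟩ | ⟨h, -⟩
  · rw [h, hdbar]
    exact Finset.prod_le_prod h0 fun t _ => min_le_left _ _
  · rw [h]
    refine (Finset.prod_le_prod h0 fun t _ => min_le_right _ _).trans (le_of_eq ?_)
    simp

theorem card_pathCode_le {L d_in : ℕ} {d : ℕ → ℕ} {M n : ℕ} (hL : 2 ≤ L) (hdin : 1 ≤ d_in)
    (hdmid : ∀ ℓ, 0 < ℓ → ℓ < L → 2 ≤ d ℓ) (hM : 0 < M) (hn : n ≤ M) :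
    (Fintype.card (Fin (M + 1) × PathCode L d_in d M n) : ℝ) ≤
      Real.exp (((L : ℝ) - 2) * M * Real.log (min (dbar L d) (2 * M)) +
          M * Real.log (8 * Real.exp 1 * d_in)) := by
  have hMr : (1 : ℝ) ≤ M := by exact_mod_cast hM
  have hdr : (1 : ℝ) ≤ d_in := by exact_mod_cast hdin
  have hcard : (Fintype.card (Fin (M + 1) × PathCode L d_in d M n) : ℝ) =
      ((M : ℝ) + 1) * ((8 * d_in) * ∏ t : Fin (L - 2), min (d (t + 2) : ℝ) (2 * M)) ^ n := by
    simp only [Fintype.card_prod, Fintype.card_fin, Fintype.card_pi, Finset.prod_const,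
      Fintype.card_bool, Finset.card_univ]
    push_cast
    rw [Finset.prod_pow]
    have h8 : (8 : ℝ) ^ n = 4 ^ n * 2 ^ n := by rw [← mul_pow]; norm_num
    simp only [mul_pow, h8]
    ring
  have hmin1 : ∀ t : Fin (L - 2), (1 : ℝ) ≤ min (d (t + 2) : ℝ) (2 * M) := fun t => by
    have := hdmid (t + 2) (by omega) (by omega)
    refine le_min ?_ (by linarith)
    exact_mod_cast (by omega : 1 ≤ d (t + 2))
  have hprod1 : (1 : ℝ) ≤ ∏ t : Fin (L - 2), min (d (t + 2) : ℝ) (2 * M) :=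
    Finset.one_le_prod fun t _ => hmin1 t
  have hbpos : 0 < min (dbar L d) (2 * M) := by
    refine lt_min (Real.rpow_pos_of_pos (Finset.prod_pos fun ℓ hℓ => ?_) _) (by linarith)
    rw [Finset.mem_Icc] at hℓ
    have := hdmid ℓ (by omega) (by omega)
    exact_mod_cast (by omega : 0 < d ℓ)
  have hexp : Real.exp (((L : ℝ) - 2) * M * Real.log (min (dbar L d) (2 * M)) +
      M * Real.log (8 * Real.exp 1 * d_in)) =
      (Real.exp 1) ^ M * ((8 * d_in) * min (dbar L d) (2 * M) ^ (L - 2)) ^ M := by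
    have hcast : ((L : ℝ) - 2) = ((L - 2 : ℕ) : ℝ) := by
      rw [Nat.cast_sub hL, Nat.cast_ofNat]
    rw [Real.exp_add, hcast, ← Nat.cast_mul, Real.exp_nat_mul, Real.exp_nat_mul,
      Real.exp_log hbpos, Real.exp_log (by positivity), pow_mul, ← mul_pow, ← mul_pow]
    ring
  rw [hcard, hexp]
  refine mul_le_mul ?_ ?_ (by positivity) (by positivity)
  · rw [← Real.exp_nat_mul, mul_one]
    exact Real.add_one_le_exp _
  · refine (pow_le_pow_right₀ (by nlinarith) hn).trans (pow_le_pow_left₀ (by positivity) ?_ M)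
    exact mul_le_mul_of_nonneg_left (prod_min_le_min_dbar_pow hL _ (by linarith)) (by positivity)

end Coding

section Sampling

variable {Ω : Type*} [Fintype Ω]

/-- Slicing the path distribution by the average inverse root mass of the visited units keeps
the total root count of every sample that omits the top slice below its expected value. -/
theorem exists_slices_sum_sqrt_groupCard_le {L n : ℕ} {d : ℕ → ℕ} (P : Ω → ℝ) (hP : ∀ ω, 0 ≤ P ω)
    (hP1 : ∑ ω, P ω = 1) (J : ℕ → Ω → ℕ) (hJ : ∀ ℓ ≤ L, ∀ ω, J ℓ ω < d ℓ) (p : ℕ → ℕ → ℝ)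
    (hp : ∀ ℓ j, 0 ≤ p ℓ j)
    (hmarg : ∀ ℓ ≤ L, ∀ h : ℕ → ℝ, ∑ ω, P ω * h (J ℓ ω) = ∑ i ∈ Finset.range (d ℓ), p ℓ i * h i) :
    ∃ q : ℕ → Ω → ℝ, (∀ k ω, 0 ≤ q k ω) ∧ (∀ k < n + 1, ∑ ω, q k ω = 1) ∧
      (∀ ω, ∑ k ∈ Finset.range (n + 1), q k ω = (n + 1 : ℝ) * P ω) ∧
      ∀ s : Fin n → Ω, (∀ k : Fin n, 0 < q k (s k)) →
        ∑ ℓ ∈ Finset.range L, ∑ j ∈ Finset.range (d ℓ),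
          Real.sqrt (groupCard (fun ℓ k => J ℓ (s k)) ℓ j) ≤
        Real.sqrt (n + 1) * ∑ ℓ ∈ Finset.range L, ∑ j ∈ Finset.range (d ℓ), Real.sqrt (p ℓ j) := by
  set ψ : Ω → ℝ := fun ω => ∑ ℓ ∈ Finset.range L, (Real.sqrt (p ℓ (J ℓ ω)))⁻¹ / 2 with hψ
  have hψ0 : ∀ ω, 0 ≤ ψ ω := fun ω => Finset.sum_nonneg fun ℓ _ => by positivity
  obtain ⟨q, t, hq0, hq1, hqsum, hqt, -⟩ := exists_slices ψ (n + 1) (fun ω => (n + 1 : ℝ) * P ω)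
    (fun ω => mul_nonneg (by positivity) (hP ω)) (by rw [← Finset.mul_sum, hP1]; simp) (∑ ω, ψ ω)
    fun ω _ => Finset.single_le_sum (fun ω _ => hψ0 ω) (Finset.mem_univ ω)
  refine ⟨q, hq0, hq1, hqsum, fun s hs => ?_⟩
  set T := ∑ ℓ ∈ Finset.range L, ∑ j ∈ Finset.range (d ℓ), Real.sqrt (p ℓ j) with hT
  have hPψ : ∑ ω, P ω * ψ ω = T / 2 := by
    simp only [hψ, Finset.mul_sum]
    rw [Finset.sum_comm, hT, Finset.sum_div]
    refine Finset.sum_congr rfl fun ℓ hℓ => ?_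
    rw [hmarg ℓ (Finset.mem_range.1 hℓ).le fun i => (Real.sqrt (p ℓ i))⁻¹ / 2, Finset.sum_div]
    refine Finset.sum_congr rfl fun j _ => ?_
    have h := Real.div_sqrt (x := p ℓ j)
    rw [div_eq_mul_inv] at h
    linear_combination h / 2
  have hsψ : ∑ k, ψ (s k) ≤ (n + 1) * (T / 2) := by
    have h1 : ∀ k < n, t (k + 1) ≤ ∑ ω, q (k + 1) ω * ψ ω := fun k hk => by
      rw [← one_mul (t (k + 1)), ← hq1 (k + 1) (by omega), Finset.sum_mul]
      refine Finset.sum_le_sum fun ω _ => ?_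
      rcases (hq0 (k + 1) ω).eq_or_lt with h | h
      · simp [← h]
      · exact mul_le_mul_of_nonneg_left (hqt (k + 1) (by omega) ω h).1 h.le
    calc ∑ k, ψ (s k) ≤ ∑ k : Fin n, t (k + 1) :=
          Finset.sum_le_sum fun k _ => (hqt k (by omega) _ (hs k)).2
      _ = ∑ k ∈ Finset.range n, t (k + 1) := Fin.sum_univ_eq_sum_range (fun k => t (k + 1)) n
      _ ≤ ∑ k ∈ Finset.range n, ∑ ω, q (k + 1) ω * ψ ω :=
          Finset.sum_le_sum fun k hk => h1 k (Finset.mem_range.1 hk)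
      _ ≤ ∑ k ∈ Finset.range (n + 1), ∑ ω, q k ω * ψ ω := by
          rw [Finset.sum_range_succ']
          exact le_add_of_nonneg_right
            (Finset.sum_nonneg fun ω _ => mul_nonneg (hq0 _ _) (hψ0 _))
      _ = (n + 1) * (T / 2) := by
          rw [Finset.sum_comm, ← hPψ, Finset.mul_sum]
          refine Finset.sum_congr rfl fun ω _ => ?_
          rw [← Finset.sum_mul, hqsum, mul_assoc]
  have hr : 0 < Real.sqrt ((n : ℝ) + 1) := Real.sqrt_pos.2 (by positivity)
  have hpos : ∀ ℓ ≤ L, ∀ k, 0 < p ℓ (J ℓ (s k)) := by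
    intro ℓ hℓ k
    have hPpos : 0 < P (s k) := by
      have h1 : q k (s k) ≤ (n + 1 : ℝ) * P (s k) := by
        rw [← hqsum]
        exact Finset.single_le_sum (f := fun i => q i (s k)) (fun i _ => hq0 i _)
          (Finset.mem_range.2 (by omega))
      by_contra! h
      nlinarith [hs k]
    have h2 := hmarg ℓ hℓ fun i => if i = J ℓ (s k) then 1 else 0
    simp only [mul_ite, mul_one, mul_zero, Finset.sum_ite_eq', Finset.mem_range,
      hJ ℓ hℓ (s k), if_true] at h2
    rw [← h2]
    refine hPpos.trans_le ?_
    refine le_trans (by simp) (Finset.single_le_sum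
      (f := fun ω => if J ℓ ω = J ℓ (s k) then P ω else 0) (fun ω _ => ?_) (Finset.mem_univ (s k)))
    split_ifs
    exacts [hP ω, le_rfl]
  have hamgm : ∀ ℓ ≤ L, ∀ j, Real.sqrt (groupCard (fun ℓ k => J ℓ (s k)) ℓ j) ≤
      Real.sqrt (n + 1) * Real.sqrt (p ℓ j) / 2 + (Real.sqrt (n + 1))⁻¹ *
        ∑ k with J ℓ (s k) = j, (Real.sqrt (p ℓ (J ℓ (s k))))⁻¹ / 2 := by
    intro ℓ hℓ j
    have hsum : ∑ k with J ℓ (s k) = j, (Real.sqrt (p ℓ (J ℓ (s k))))⁻¹ / 2 =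
        groupCard (fun ℓ k => J ℓ (s k)) ℓ j * ((Real.sqrt (p ℓ j))⁻¹ / 2) := by
      rw [Finset.sum_congr rfl fun k hk => by rw [(Finset.mem_filter.1 hk).2], Finset.sum_const,
        nsmul_eq_mul]
      rfl
    rw [hsum]
    rcases (hp ℓ j).eq_or_lt with h | h
    · have h0 : groupCard (fun ℓ k => J ℓ (s k)) ℓ j = 0 := by
        unfold groupCard
        rw [Finset.filter_false_of_mem fun k _ hk => by
          have hk' : J ℓ (s k) = j := hk
          exact (hpos ℓ hℓ k).ne (hk' ▸ h)]
        simp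
      rw [h0, ← h]
      simp
    · have hp' := Real.sqrt_pos.2 h
      have hK := Real.sq_sqrt (groupCard_nonneg (fun ℓ k => J ℓ (s k)) ℓ j)
      set K := groupCard (fun ℓ k => J ℓ (s k)) ℓ j
      set a := Real.sqrt K
      set r := Real.sqrt ((n : ℝ) + 1)
      set b := Real.sqrt (p ℓ j)
      have : r * b / 2 + r⁻¹ * (K * (b⁻¹ / 2)) - a = (r * b - a) ^ 2 / (2 * (r * b)) := by
        rw [← hK]
        field_simp
        ring
      have h3 : 0 ≤ (r * b - a) ^ 2 / (2 * (r * b)) := by positivity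
      linarith
  calc ∑ ℓ ∈ Finset.range L, ∑ j ∈ Finset.range (d ℓ),
          Real.sqrt (groupCard (fun ℓ k => J ℓ (s k)) ℓ j)
      ≤ ∑ ℓ ∈ Finset.range L, ∑ j ∈ Finset.range (d ℓ),
          (Real.sqrt (n + 1) * Real.sqrt (p ℓ j) / 2 + (Real.sqrt (n + 1))⁻¹ *
            ∑ k with J ℓ (s k) = j, (Real.sqrt (p ℓ (J ℓ (s k))))⁻¹ / 2) :=
        Finset.sum_le_sum fun ℓ hℓ => Finset.sum_le_sum fun j _ =>
          hamgm ℓ (Finset.mem_range.1 hℓ).le j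
    _ = Real.sqrt (n + 1) * T / 2 + (Real.sqrt (n + 1))⁻¹ * ∑ k, ψ (s k) := by
        simp only [Finset.sum_add_distrib, ← Finset.mul_sum, ← Finset.sum_div]
        rw [← hT, hψ, Finset.sum_comm (s := Finset.univ)]
        congr 2
        rw [Finset.sum_div]
        refine Finset.sum_congr rfl fun ℓ hℓ => ?_
        rw [← Finset.sum_fiberwise_of_maps_to (s := Finset.univ) (t := Finset.range (d ℓ))
          (g := fun k => J ℓ (s k))
          fun k _ => Finset.mem_range.2 (hJ ℓ (Finset.mem_range.1 hℓ).le _), Finset.sum_div]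
        simp only [Finset.sum_div]
    _ ≤ Real.sqrt (n + 1) * T / 2 + (Real.sqrt (n + 1))⁻¹ * ((n + 1) * (T / 2)) := by
        gcongr
    _ = Real.sqrt (n + 1) * T := by
        have h := Real.mul_self_sqrt (show (0 : ℝ) ≤ (n : ℝ) + 1 by positivity)
        field_simp
        linear_combination (-T) * h

variable {n : ℕ} {P : Ω → ℝ} {q : ℕ → Ω → ℝ}

theorem sq_sum_mul_le (w X : Ω → ℝ) (hw : ∀ ω, 0 ≤ w ω) (hw1 : ∑ ω, w ω = 1) :
    (∑ ω, w ω * X ω) ^ 2 ≤ ∑ ω, w ω * X ω ^ 2 := by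
  have h : 0 ≤ ∑ ω, w ω * (X ω - ∑ ω, w ω * X ω) ^ 2 :=
    Finset.sum_nonneg fun ω _ => mul_nonneg (hw ω) (sq_nonneg _)
  generalize hA : ∑ ω, w ω * X ω = A at h ⊢
  have hexp : ∀ ω, w ω * (X ω - A) ^ 2 = w ω * X ω ^ 2 - 2 * A * (w ω * X ω) + A ^ 2 * w ω :=
    fun ω => by ring
  rw [Finset.sum_congr rfl fun ω _ => hexp ω, Finset.sum_add_distrib, Finset.sum_sub_distrib,
    ← Finset.mul_sum, ← Finset.mul_sum, hA, hw1] at h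
  linarith

theorem sum_slices_mul (hqsum : ∀ ω, ∑ k ∈ Finset.range (n + 1), q k ω = (n + 1 : ℝ) * P ω)
    (X : Ω → ℝ) : ∑ k ∈ Finset.range (n + 1), ∑ ω, q k ω * X ω = (n + 1) * ∑ ω, P ω * X ω := by
  rw [Finset.sum_comm, Finset.mul_sum]
  refine Finset.sum_congr rfl fun ω _ => ?_
  rw [← Finset.sum_mul, hqsum, mul_assoc]

/-- Omitting the top slice does not increase the second moment of a centered sum. -/
theorem sum_prod_mul_sq_le_of_centered (hq0 : ∀ k ω, 0 ≤ q k ω)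
    (hq1 : ∀ k < n + 1, ∑ ω, q k ω = 1)
    (hqsum : ∀ ω, ∑ k ∈ Finset.range (n + 1), q k ω = (n + 1 : ℝ) * P ω)
    (X : Ω → ℝ) (hX : ∑ ω, P ω * X ω = 0) :
    ∑ s : Fin n → Ω, (∏ k : Fin n, q k (s k)) * (∑ k, X (s k)) ^ 2 ≤
      (n + 1) * ∑ ω, P ω * X ω ^ 2 := by
  have h := sum_prod_mul_sq n q (fun k hk => hq1 k (by omega)) X 0
  simp only [zero_add] at h
  rw [h, ← sum_slices_mul hqsum fun ω => X ω ^ 2, Finset.sum_range_succ, Finset.sum_sub_distrib]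
  have h1 := sum_slices_mul hqsum X
  rw [Finset.sum_range_succ, hX, mul_zero] at h1
  have h2 := sq_sum_mul_le (q n) X (hq0 n) (hq1 n (by omega))
  have h3 : 0 ≤ ∑ k ∈ Finset.range n, (∑ ω, q k ω * X ω) ^ 2 :=
    Finset.sum_nonneg fun k _ => sq_nonneg _
  rw [show ∑ k ∈ Finset.range n, ∑ ω, q k ω * X ω = -∑ ω, q n ω * X ω by linarith, neg_sq]
  linarith

/-- The variance saved by the slack `n + 1 - n` pays for a slight rescaling of a bounded sum. -/
theorem sum_prod_mul_sq_le_of_abs_le_one (hq0 : ∀ k ω, 0 ≤ q k ω)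
    (hq1 : ∀ k < n + 1, ∑ ω, q k ω = 1)
    (hqsum : ∀ ω, ∑ k ∈ Finset.range (n + 1), q k ω = (n + 1 : ℝ) * P ω) (hn : 4 ≤ n)
    (X : Ω → ℝ) (hX : ∀ ω, |X ω| ≤ 1) {c : ℝ} (hc : c ≤ 1)
    (hcn : (1 - c) ^ 2 * (4 * (n + 1)) ≤ 1) :
    ∑ s : Fin n → Ω, (∏ k : Fin n, q k (s k)) *
      (c * ∑ k, X (s k) - (n + 1) * ∑ ω, P ω * X ω) ^ 2 ≤ (n : ℝ) + 1 := by
  have h := sum_prod_mul_sq n q (fun k hk => hq1 k (by omega)) (fun ω => c * X ω)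
    (-(((n : ℝ) + 1) * ∑ ω, P ω * X ω))
  have hX2 : ∀ ω, X ω ^ 2 ≤ 1 := fun ω => (sq_le_one_iff_abs_le_one _).2 (hX ω)
  have hmul : ∀ k, ∑ ω, q k ω * (c * X ω) = c * ∑ ω, q k ω * X ω := fun k => by
    rw [Finset.mul_sum]
    exact Finset.sum_congr rfl fun ω _ => by ring
  have hsq : ∀ k, ∑ ω, q k ω * (c * X ω) ^ 2 = c ^ 2 * ∑ ω, q k ω * X ω ^ 2 := fun k => by
    rw [Finset.mul_sum]
    exact Finset.sum_congr rfl fun ω _ => by ring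
  have hle1 : ∀ k < n + 1, ∑ ω, q k ω * X ω ^ 2 ≤ 1 := fun k hk => by
    rw [← hq1 k hk]
    exact Finset.sum_le_sum fun ω _ => mul_le_of_le_one_right (hq0 k ω) (hX2 ω)
  have hmean : ∀ k < n + 1, (∑ ω, q k ω * X ω) ^ 2 ≤ 1 := fun k hk =>
    (sq_sum_mul_le (q k) X (hq0 k) (hq1 k hk)).trans (hle1 k hk)
  simp only [hmul, hsq, ← Finset.mul_sum] at h
  have hcomm : ∀ s : Fin n → Ω, c * ∑ k, X (s k) - (n + 1) * ∑ ω, P ω * X ω =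
      -((n + 1) * ∑ ω, P ω * X ω) + c * ∑ k, X (s k) := fun s => by ring
  simp only [hcomm, h, mul_pow]
  rw [← sum_slices_mul hqsum X, Finset.sum_range_succ]
  have hE : ∑ k ∈ Finset.range n, ∑ ω, q k ω * X ω ^ 2 ≤ n := by
    refine (Finset.sum_le_sum fun k hk => hle1 k (by have := Finset.mem_range.1 hk; omega)).trans ?_
    simp
  have hQ : (∑ k ∈ Finset.range n, ∑ ω, q k ω * X ω) ^ 2 ≤
      n * ∑ k ∈ Finset.range n, (∑ ω, q k ω * X ω) ^ 2 := by
    simpa using sq_sum_le_card_mul_sum_sq (s := Finset.range n) (f := fun k => ∑ ω, q k ω * X ω)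
  have hQn : ∑ k ∈ Finset.range n, (∑ ω, q k ω * X ω) ^ 2 ≤ n := by
    refine (Finset.sum_le_sum fun k hk => hmean k (by have := Finset.mem_range.1 hk; omega)).trans ?_
    simp
  have hQ0 : 0 ≤ ∑ k ∈ Finset.range n, (∑ ω, q k ω * X ω) ^ 2 :=
    Finset.sum_nonneg fun k _ => sq_nonneg _
  have hy := hmean n (by omega)
  rw [Finset.sum_sub_distrib, ← Finset.mul_sum, ← Finset.mul_sum]
  generalize ∑ k ∈ Finset.range n, ∑ ω, q k ω * X ω ^ 2 = E at *
  generalize ∑ k ∈ Finset.range n, (∑ ω, q k ω * X ω) ^ 2 = Q at *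
  generalize ∑ k ∈ Finset.range n, ∑ ω, q k ω * X ω = Y at *
  generalize ∑ ω, q n ω * X ω = y at *
  have hnr : (4 : ℝ) ≤ n := by exact_mod_cast hn
  obtain ⟨η, rfl⟩ : ∃ η, c = 1 - η := ⟨1 - c, by ring⟩
  have hη0 : 0 ≤ η := by linarith
  have hηn : η ^ 2 * (4 * (n + 1)) ≤ 1 := by simpa using hcn
  have hη : η ≤ 9 / 40 := by
    by_contra! hlt
    nlinarith
  have hYy : (η * Y + y) ^ 2 ≤ Q / 4 + (7 / 20 * Q + 20 / 7 * (η ^ 2 * n)) + 1 := by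
    have h1 : η ^ 2 * Y ^ 2 ≤ Q / 4 := by
      have := mul_le_mul_of_nonneg_left hQ (sq_nonneg η)
      nlinarith
    have h2 : 2 * (η * Y * y) ≤ 7 / 20 * Q + 20 / 7 * (η ^ 2 * n) := by
      have hnpos : (0 : ℝ) < n := by linarith
      have h3 : 7 / 20 * (Y ^ 2 / n) ≤ 7 / 20 * Q := by
        have : Y ^ 2 / n ≤ Q := by rw [div_le_iff₀ hnpos]; linarith
        linarith
      have h4 : 2 * (η * Y * y) ≤ 7 / 20 * (Y ^ 2 / n) + 20 / 7 * (η ^ 2 * n) * y ^ 2 := by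
        have : 7 / 20 * (Y ^ 2 / n) + 20 / 7 * (η ^ 2 * n) * y ^ 2 - 2 * (η * Y * y) =
            (7 * Y - 20 * (η * n * y)) ^ 2 / (140 * n) := by
          field_simp
          ring
        have h5 : 0 ≤ (7 * Y - 20 * (η * n * y)) ^ 2 / (140 * n) := by positivity
        linarith
      have h6 : 20 / 7 * (η ^ 2 * n) * y ^ 2 ≤ 20 / 7 * (η ^ 2 * n) :=
        mul_le_of_le_one_right (by positivity) hy
      linarith
    nlinarith
  have hE' : (1 - η) ^ 2 * E ≤ (1 - η) ^ 2 * n := mul_le_mul_of_nonneg_left hE (sq_nonneg _)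
  have hs : 3 / 5 ≤ (1 - η) ^ 2 := by nlinarith
  have hsQ : 3 / 5 * Q ≤ (1 - η) ^ 2 * Q := mul_le_mul_of_nonneg_right hs hQ0
  have hlast : 20 / 7 * (η ^ 2 * n) ≤ (1 - (1 - η) ^ 2) * n := by
    have : 0 ≤ η * n := by positivity
    nlinarith
  have hrw : (-(Y + y) + (1 - η) * Y) ^ 2 = (η * Y + y) ^ 2 := by ring
  rw [hrw]
  linarith

end Sampling

section SamplingError

variable {Ω : Type*} [Fintype Ω]

/-- Mean square error of the sampled path outputs, for one input. -/
theorem sum_prod_mul_sq_pathOutput_sub_le {L n : ℕ} {d : ℕ → ℕ} (hL : 0 < L) (hd0 : d 0 = 1)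
    {P : Ω → ℝ} {q : ℕ → Ω → ℝ} (J : ℕ → Ω → ℕ) (hJ : ∀ ℓ ≤ L, ∀ ω, J ℓ ω < d ℓ)
    (pr : ℕ → ℕ → ℕ → ℝ) (p : ℕ → ℕ → ℝ) (hpr : ∀ ℓ i j, 0 ≤ pr ℓ i j) (hp : ∀ ℓ i, 0 ≤ p ℓ i)
    (hp0 : p 0 0 = 1)
    (hrow : ∀ ℓ < L, ∀ i < d ℓ, ∑ j ∈ Finset.range (d (ℓ + 1)), pr ℓ i j = p ℓ i)
    (htrans : ∀ ℓ < L, ∀ h : ℕ → ℕ → ℝ, ∑ ω, P ω * h (J ℓ ω) (J (ℓ + 1) ω) =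
        ∑ i ∈ Finset.range (d ℓ), ∑ j ∈ Finset.range (d (ℓ + 1)), pr ℓ i j * h i j)
    (hq0 : ∀ k ω, 0 ≤ q k ω) (hq1 : ∀ k < n + 1, ∑ ω, q k ω = 1)
    (hqsum : ∀ ω, ∑ k ∈ Finset.range (n + 1), q k ω = (n + 1 : ℝ) * P ω) (hn : 4 ≤ n)
    {c : ℝ} (hc0 : 0 ≤ c) (hc : c ≤ 1) (hcn : (1 - c) ^ 2 * (4 * (n + 1)) ≤ 1)
    (pos : ℕ → ℕ → Bool) (g m : ℕ → ℕ → ℝ)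
    (hg : ∀ ℓ < L, ∀ j, g ℓ j = if pos ℓ j then max (m ℓ j) 0 else -max (m ℓ j) 0)
    (hg1 : ∀ ℓ ≤ L, ∀ j < d ℓ, |g ℓ j| ≤ 1)
    (hm : ∀ ℓ < L, ∀ j < d ℓ,
      p ℓ j * m ℓ j = ∑ i ∈ Finset.range (d (ℓ + 1)), pr ℓ j i * g (ℓ + 1) i) :
    ∑ s : Fin n → Ω, (∏ k : Fin n, q k (s k)) *
      (c / (n + 1) * ∑ k, pathOutput L (fun ℓ k => (pos ℓ (J ℓ (s k)), J ℓ (s k)))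
        (fun k => g L (J L (s k))) (L - 1) k - m 0 0) ^ 2 ≤
      (∑ ℓ ∈ Finset.range L, ∑ j ∈ Finset.range (d ℓ), Real.sqrt (p ℓ j)) ^ 2 / (n + 1) := by
  have hn1 : (0 : ℝ) < (n : ℝ) + 1 := by positivity
  set A : (Σ _ : ℕ, ℕ) → (Fin n → Ω) → ℝ := fun i s =>
    if i.1 = 0 then |c / (n + 1) * ∑ k, g 1 (J 1 (s k)) - m 0 0|
    else c / (n + 1) * |∑ k with J i.1 (s k) = i.2, (g (i.1 + 1) (J (i.1 + 1) (s k)) - m i.1 i.2)|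
    with hA
  set t := (Finset.range L).sigma fun ℓ => Finset.range (d ℓ) with ht
  have hwnn : ∀ s : Fin n → Ω, 0 ≤ ∏ k : Fin n, q k (s k) :=
    fun s => Finset.prod_nonneg fun k _ => hq0 _ _
  have hpoint : ∀ s : Fin n → Ω, |c / (n + 1) *
      ∑ k, pathOutput L (fun ℓ k => (pos ℓ (J ℓ (s k)), J ℓ (s k)))
        (fun k => g L (J L (s k))) (L - 1) k - m 0 0| ≤ ∑ i ∈ t, A i s := by
    intro s
    have h1 := sum_abs_pathOutput_sub_le d pos (fun ℓ k => J ℓ (s k)) (fun ℓ hℓ k => hJ ℓ hℓ.le _)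
      g m (fun ℓ _ hℓ k => hg ℓ hℓ _) Nat.one_pos hL
    rw [ht, Finset.sum_sigma, Finset.range_eq_Ico, Finset.sum_eq_sum_Ico_succ_bot hL]
    simp only [hd0, Finset.sum_range_one, hA, if_true]
    rw [Finset.sum_congr rfl fun ℓ hℓ => Finset.sum_congr rfl fun j _ =>
      if_neg (show ℓ ≠ 0 by have := Finset.mem_Ico.1 hℓ; omega)]
    simp only [← Finset.mul_sum]
    set Y := pathOutput L (fun ℓ k => (pos ℓ (J ℓ (s k)), J ℓ (s k)))
      (fun k => g L (J L (s k))) (L - 1)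
    have h2 : c / (n + 1) * ∑ k, Y k - m 0 0 = (c / (n + 1) * ∑ k, g 1 (J 1 (s k)) - m 0 0) +
        c / (n + 1) * ∑ k, (Y k - g 1 (J 1 (s k))) := by
      rw [Finset.sum_sub_distrib]
      ring
    rw [h2]
    refine (abs_add_le _ _).trans (add_le_add_right ?_ _)
    rw [abs_mul, abs_of_nonneg (by positivity : 0 ≤ c / ((n : ℝ) + 1))]
    exact mul_le_mul_of_nonneg_left ((Finset.abs_sum_le_sum_abs _ _).trans h1) (by positivity)
  have hmean0 : ∑ ω, P ω * g 1 (J 1 ω) = m 0 0 := by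
    rw [htrans 0 hL fun _ i => g 1 i, hd0, Finset.sum_range_one, ← hm 0 hL 0 (by omega), hp0,
      one_mul]
  have hsecond : ∀ i ∈ t, ∑ s : Fin n → Ω, (∏ k : Fin n, q k (s k)) * A i s ^ 2 ≤
      (Real.sqrt (p i.1 i.2) / Real.sqrt (n + 1)) ^ 2 := by
    rintro ⟨ℓ, j⟩ hi
    obtain ⟨hℓ, hj⟩ : ℓ < L ∧ j < d ℓ := by simpa [ht] using hi
    rw [div_pow, Real.sq_sqrt (hp _ _), Real.sq_sqrt hn1.le]
    rcases Nat.eq_zero_or_pos ℓ with rfl | h0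
    · obtain rfl : j = 0 := by omega
      have h := sum_prod_mul_sq_le_of_abs_le_one hq0 hq1 hqsum hn (fun ω => g 1 (J 1 ω))
        (fun ω => hg1 1 hL _ (hJ 1 hL _)) hc hcn
      simp only [hmean0] at h
      have hterm : ∀ s, A ⟨0, 0⟩ s ^ 2 =
          (c * ∑ k, g 1 (J 1 (s k)) - (n + 1) * m 0 0) ^ 2 / ((n : ℝ) + 1) ^ 2 := fun s => by
        simp only [hA, if_true, sq_abs]
        field_simp
      simp only [hterm, ← mul_div_assoc]
      rw [← Finset.sum_div, hp0, div_le_div_iff₀ (by positivity) hn1]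
      nlinarith
    · set X : Ω → ℝ := fun ω => if J ℓ ω = j then g (ℓ + 1) (J (ℓ + 1) ω) - m ℓ j else 0 with hX
      have hmulX : ∀ i' i, pr ℓ i' i * (if i' = j then g (ℓ + 1) i - m ℓ j else 0) =
          if i' = j then pr ℓ j i * g (ℓ + 1) i - pr ℓ j i * m ℓ j else 0 := fun i' i => by
        split_ifs with h
        · rw [h]; ring
        · ring
      have hmean : ∑ ω, P ω * X ω = 0 := by
        rw [htrans ℓ hℓ fun i' i => if i' = j then g (ℓ + 1) i - m ℓ j else 0, Finset.sum_comm]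
        simp only [hmulX, Finset.sum_ite_eq', Finset.mem_range, hj, if_true]
        rw [Finset.sum_sub_distrib, ← Finset.sum_mul, hrow ℓ hℓ j hj, ← hm ℓ hℓ j hj, sub_self]
      have hvar : ∑ ω, P ω * X ω ^ 2 ≤ p ℓ j := by
        have hX2 : ∀ ω, X ω ^ 2 =
            if J ℓ ω = j then (g (ℓ + 1) (J (ℓ + 1) ω) - m ℓ j) ^ 2 else 0 := fun ω => by
          simp only [hX]
          split_ifs <;> simp
        have hmulX2 : ∀ i' i, pr ℓ i' i * (if i' = j then (g (ℓ + 1) i - m ℓ j) ^ 2 else 0) =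
            if i' = j then pr ℓ j i * g (ℓ + 1) i ^ 2 - 2 * m ℓ j * (pr ℓ j i * g (ℓ + 1) i) +
              m ℓ j ^ 2 * pr ℓ j i else 0 := fun i' i => by
          split_ifs with h
          · rw [h]; ring
          · ring
        simp only [hX2]
        rw [htrans ℓ hℓ fun i' i => if i' = j then (g (ℓ + 1) i - m ℓ j) ^ 2 else 0,
          Finset.sum_comm]
        simp only [hmulX2, Finset.sum_ite_eq', Finset.mem_range, hj, if_true]
        rw [Finset.sum_add_distrib, Finset.sum_sub_distrib, ← Finset.mul_sum, ← Finset.mul_sum,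
          hrow ℓ hℓ j hj, ← hm ℓ hℓ j hj]
        have hg2 : ∑ i ∈ Finset.range (d (ℓ + 1)), pr ℓ j i * g (ℓ + 1) i ^ 2 ≤ p ℓ j := by
          rw [← hrow ℓ hℓ j hj]
          exact Finset.sum_le_sum fun i hi => mul_le_of_le_one_right (hpr _ _ _)
            ((sq_le_one_iff_abs_le_one _).2 (hg1 _ hℓ i (Finset.mem_range.1 hi)))
        have := mul_nonneg (hp ℓ j) (sq_nonneg (m ℓ j))
        nlinarith
      have h := (sum_prod_mul_sq_le_of_centered hq0 hq1 hqsum X hmean).trans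
        (mul_le_mul_of_nonneg_left hvar hn1.le)
      have hterm : ∀ s, A ⟨ℓ, j⟩ s ^ 2 = c ^ 2 / ((n : ℝ) + 1) ^ 2 * (∑ k, X (s k)) ^ 2 :=
        fun s => by
          simp only [hA, if_neg h0.ne', hX, mul_pow, sq_abs, div_pow, Finset.sum_filter]
      have hcomm : ∀ a b e : ℝ, a * (b * e) = b * (a * e) := fun a b e => by ring
      simp only [hterm, hcomm _ (c ^ 2 / ((n : ℝ) + 1) ^ 2), ← Finset.mul_sum]
      have hc2 : c ^ 2 ≤ 1 := pow_le_one₀ hc0 hc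
      calc _ ≤ c ^ 2 / ((n : ℝ) + 1) ^ 2 * (((n : ℝ) + 1) * p ℓ j) :=
            mul_le_mul_of_nonneg_left h (by positivity)
        _ = c ^ 2 * (p ℓ j / (n + 1)) := by field_simp
        _ ≤ p ℓ j / (n + 1) := mul_le_of_le_one_left (div_nonneg (hp _ _) hn1.le) hc2
  refine (Finset.sum_le_sum fun s _ => mul_le_mul_of_nonneg_left
    (sq_le_sq' (neg_le_of_abs_le (hpoint s)) (le_of_abs_le (hpoint s))) (hwnn s)).trans ?_
  refine (sum_mul_sq_sum_le _ hwnn t A (fun i => Real.sqrt (p i.1 i.2) / Real.sqrt (n + 1))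
    (fun i _ => by positivity) hsecond).trans (le_of_eq ?_)
  rw [← Finset.sum_div, div_pow, Real.sq_sqrt hn1.le, ht, Finset.sum_sigma]

end SamplingError

theorem exists_pos_weight_le {S : Type*} [Fintype S] (w a : S → ℝ) (hw : ∀ s, 0 ≤ w s)
    (hw1 : ∑ s, w s = 1) {B : ℝ} (h : ∑ s, w s * a s ≤ B) : ∃ s, 0 < w s ∧ a s ≤ B := by
  by_contra! hlt
  obtain ⟨s, hs⟩ : ∃ s, 0 < w s := by
    by_contra! h0
    have := Finset.sum_nonpos fun s (_ : s ∈ Finset.univ) => h0 s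
    linarith
  have : ∑ s, w s * B < ∑ s, w s * a s := by
    refine Finset.sum_lt_sum (fun s _ => ?_) ⟨s, Finset.mem_univ s, ?_⟩
    · rcases (hw s).eq_or_lt with h0 | h0
      · simp [← h0]
      · exact mul_le_mul_of_nonneg_left (hlt s h0).le h0.le
    · exact mul_lt_mul_of_pos_left (hlt s hs) hs
  rw [← Finset.sum_mul, hw1, one_mul] at this
  linarith

namespace RampNet

variable {L d_in : ℕ} {d : ℕ → ℕ}

theorem Vtot_le_compVar (hL : 0 < L) (hd0 : d 0 = 1) (net : RampNet L d_in d) :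
    net.Vtot ≤ net.compVar := by
  refine le_trans ?_ (balanced_le_compVar hd0 net)
  have hlayer : ∀ ℓ ∈ Finset.range L, net.Vtot ≤ (∑ j ∈ Finset.range (d ℓ),
      Real.sqrt (net.unitOut ℓ j * unitIn L d net.W (L - ℓ) j)) * Real.sqrt net.Vtot := by
    intro ℓ hℓ
    have hsum := sum_unitOut_mul_unitIn hd0 net (Finset.mem_range.1 hℓ).le
    have hnn : ∀ j, 0 ≤ net.unitOut ℓ j * unitIn L d net.W (L - ℓ) j := fun j =>
      mul_nonneg (net.unitOut_nonneg ℓ j) (unitIn_nonneg net.W_nonneg _ _)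
    rw [Finset.sum_mul]
    refine hsum.symm.le.trans (Finset.sum_le_sum fun j hj => ?_)
    rw [← Real.sqrt_mul (hnn j)]
    refine Real.le_sqrt_of_sq_le ?_
    rw [sq]
    refine mul_le_mul_of_nonneg_left ?_ (hnn j)
    rw [← hsum]
    exact Finset.single_le_sum (f := fun j => net.unitOut ℓ j * unitIn L d net.W (L - ℓ) j)
      (fun j _ => hnn j) hj
  have h := Finset.sum_le_sum hlayer
  rw [Finset.sum_const, Finset.card_range, nsmul_eq_mul, ← Finset.sum_mul] at h
  have hLr : (0 : ℝ) < L := by exact_mod_cast hL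
  rw [one_div, mul_assoc, ← div_eq_inv_mul, le_div_iff₀ hLr]
  linarith

theorem integrable_abs_eval_sub_sq (hL : 1 ≤ L) (hd0 : d 0 = 1) (hdL : d L = 2 * d_in)
    (net net' : RampNet L d_in d) (P : Measure (ℕ → ℝ)) [IsProbabilityMeasure P]
    (hP : ∀ᵐ x ∂P, ∀ i < d_in, |x i| ≤ 1) :
    Integrable (fun x => |net.eval x - net'.eval x| ^ 2) P := by
  refine Integrable.of_bound ((net.measurable_eval.sub net'.measurable_eval).abs.pow_const
    2).aestronglyMeasurable ((net.Vtot + net'.Vtot) ^ 2) ?_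
  filter_upwards [hP] with x hx
  rw [Real.norm_eq_abs, abs_pow, abs_abs]
  refine pow_le_pow_left₀ (abs_nonneg _) ((abs_sub _ _).trans ?_) 2
  exact add_le_add (abs_eval_le hL hd0 hdL net hx) (abs_eval_le hL hd0 hdL net' hx)

/-- A network is approximated by sampled networks of no larger composite variation. -/
theorem exists_sampledNet (hL : 0 < L) (hd0 : d 0 = 1) (hdL : d L = 2 * d_in)
    (net : RampNet L d_in d) (hV : 0 < net.Vtot) {v : ℝ} (hv : net.compVar ≤ v) {n : ℕ}
    (hn : 4 ≤ n) {c : ℝ} (hc0 : 0 ≤ c) (hc : c ≤ 1) (hcn : (1 - c) ^ 2 * (4 * (n + 1)) ≤ 1)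
    (P : Measure (ℕ → ℝ)) [IsProbabilityMeasure P]
    (hP : ∀ᵐ x ∂P, ∀ i < d_in, |x i| ≤ 1) :
    ∃ J : ℕ → Fin n → ℕ, (∀ ℓ ≤ L, ∀ k, J ℓ k < d ℓ) ∧
      (sampledNet L d_in d (net.Vtot * c / (n + 1)) J).compVar ≤ v ∧
      ∫ x, |net.eval x - (sampledNet L d_in d (net.Vtot * c / (n + 1)) J).eval x| ^ 2 ∂P ≤
        (L : ℝ) ^ 2 * v ^ 2 / (n + 1) := by
  have hLr : (0 : ℝ) < L := by exact_mod_cast hL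
  have hn1 : (0 : ℝ) < (n : ℝ) + 1 := by positivity
  set V := net.Vtot with hVdef
  set U : ℕ → ℕ → ℝ := fun ℓ j => unitIn L d net.W (L - ℓ) j with hU
  have hU0 : ∀ ℓ j, 0 ≤ U ℓ j := fun ℓ j => unitIn_nonneg net.W_nonneg _ _
  have hUstep : ∀ ℓ < L, ∀ j, U ℓ j = ∑ i ∈ Finset.range (d (ℓ + 1)), net.W ℓ j i * U (ℓ + 1) i :=
    fun ℓ hℓ j => unitIn_sub hℓ j
  have hout := net.unitOut_nonneg
  set p : ℕ → ℕ → ℝ := fun ℓ j => net.unitOut ℓ j * U ℓ j / V with hpdef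
  set pr : ℕ → ℕ → ℕ → ℝ := fun ℓ i j => net.unitOut ℓ i * net.W ℓ i j * U (ℓ + 1) j / V
    with hprdef
  have hp : ∀ ℓ j, 0 ≤ p ℓ j := fun ℓ j =>
    div_nonneg (mul_nonneg (hout _ _) (hU0 _ _)) hV.le
  have hpr : ∀ ℓ i j, 0 ≤ pr ℓ i j := fun ℓ i j =>
    div_nonneg (mul_nonneg (mul_nonneg (hout _ _) (net.W_nonneg _ _ _)) (hU0 _ _)) hV.le
  have hp1 : ∀ ℓ ≤ L, ∑ j ∈ Finset.range (d ℓ), p ℓ j = 1 := fun ℓ hℓ => by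
    rw [← Finset.sum_div, sum_unitOut_mul_unitIn hd0 net hℓ, div_self hV.ne']
  have hrow : ∀ ℓ < L, ∀ i < d ℓ, ∑ j ∈ Finset.range (d (ℓ + 1)), pr ℓ i j = p ℓ i :=
    fun ℓ hℓ i _ => by
      simp only [hprdef, hpdef, hUstep ℓ hℓ i, ← Finset.sum_div, Finset.mul_sum, mul_assoc]
  have hcol : ∀ ℓ < L, ∀ j < d (ℓ + 1), ∑ i ∈ Finset.range (d ℓ), pr ℓ i j = p (ℓ + 1) j :=
    fun ℓ _ j _ => by
      simp only [hprdef, hpdef, unitOut_succ, ← Finset.sum_div, Finset.sum_mul]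
  obtain ⟨Ω, _, Q, J, hQ0, hQ1, hJ, hmarg, htrans⟩ := exists_path_space d pr p L hpr hp
    (hp1 0 (Nat.zero_le _)) hrow hcol
  obtain ⟨q, hq0, hq1, hqsum, hqT⟩ := exists_slices_sum_sqrt_groupCard_le (n := n) Q hQ0 hQ1 J hJ
    p hp hmarg
  set T := ∑ ℓ ∈ Finset.range L, ∑ j ∈ Finset.range (d ℓ), Real.sqrt (p ℓ j) with hT
  have hT0 : 0 ≤ T := Finset.sum_nonneg fun _ _ => Finset.sum_nonneg fun _ _ => Real.sqrt_nonneg _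
  have hVT : V * T ≤ L * v := by
    have h := (balanced_le_compVar hd0 net).trans hv
    have hsqrt : ∀ ℓ j, Real.sqrt (net.unitOut ℓ j * unitIn L d net.W (L - ℓ) j) =
        Real.sqrt V * Real.sqrt (p ℓ j) := fun ℓ j => by
      rw [← Real.sqrt_mul hV.le, hpdef]
      congr 1
      field_simp
      rfl
    simp only [hsqrt, ← Finset.mul_sum] at h
    rw [← hT, ← hVdef, one_div, mul_assoc, ← div_eq_inv_mul, div_le_iff₀ hLr] at h
    have h2 := Real.mul_self_sqrt hV.le
    nlinarith
  set α := V * c / (n + 1) with hα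
  have hα0 : 0 ≤ α := by positivity
  set w : (Fin n → Ω) → ℝ := fun s => ∏ k : Fin n, q k (s k) with hw
  have hJs : ∀ s : Fin n → Ω, ∀ ℓ ≤ L, ∀ k, J ℓ (s k) < d ℓ := fun s ℓ hℓ k => hJ ℓ hℓ _
  have hpoint : ∀ x : ℕ → ℝ, (∀ i < d_in, |x i| ≤ 1) → ∑ s, w s *
      |net.eval x - (sampledNet L d_in d α fun ℓ k => J ℓ (s k)).eval x| ^ 2 ≤
        (L : ℝ) ^ 2 * v ^ 2 / (n + 1) := by
    intro x hx
    set z : ℕ → ℕ → ℝ := fun ℓ j => zRev L d_in d net.W x (L - ℓ) j with hz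
    have hzU : ∀ ℓ ≤ L, ∀ j < d ℓ, |z ℓ j| ≤ U ℓ j := fun ℓ hℓ j hj =>
      abs_zRev_le net.W_nonneg hdL hx j (by rwa [Nat.sub_sub_self hℓ])
    set g : ℕ → ℕ → ℝ := fun ℓ j => z ℓ j / U ℓ j with hgdef
    set m : ℕ → ℕ → ℝ := fun ℓ j =>
      (∑ i ∈ Finset.range (d (ℓ + 1)), net.W ℓ j i * z (ℓ + 1) i) / U ℓ j with hmdef
    have hgU : ∀ ℓ ≤ L, ∀ j < d ℓ, U ℓ j * g ℓ j = z ℓ j := fun ℓ hℓ j hj => by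
      rcases (hU0 ℓ j).eq_or_lt with h | h
      · have := hzU ℓ hℓ j hj
        rw [← h] at this
        rw [← h, zero_mul, abs_nonpos_iff.1 this]
      · exact mul_div_cancel₀ _ h.ne'
    have hg : ∀ ℓ < L, ∀ j, g ℓ j =
        if decide (j < d ℓ / 2) then max (m ℓ j) 0 else -max (m ℓ j) 0 := fun ℓ hℓ j => by
      have hmax : ∀ S : ℝ, max (S / U ℓ j) 0 = max S 0 / U ℓ j := fun S => by
        rw [max_div_div_right (hU0 ℓ j) S 0 |>.symm, zero_div]
      simp only [hgdef, hmdef, hz, hmax, decide_eq_true_eq, zRev_sub hℓ]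
      split_ifs
      · rfl
      · rw [neg_div]
    have hg1 : ∀ ℓ ≤ L, ∀ j < d ℓ, |g ℓ j| ≤ 1 := fun ℓ hℓ j hj => by
      rw [hgdef, abs_div, abs_of_nonneg (hU0 ℓ j)]
      exact div_le_one_of_le₀ (hzU ℓ hℓ j hj) (hU0 ℓ j)
    have hm : ∀ ℓ < L, ∀ j < d ℓ,
        p ℓ j * m ℓ j = ∑ i ∈ Finset.range (d (ℓ + 1)), pr ℓ j i * g (ℓ + 1) i := by
      intro ℓ hℓ j hj
      have hterm : ∀ i ∈ Finset.range (d (ℓ + 1)), pr ℓ j i * g (ℓ + 1) i =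
          net.unitOut ℓ j / V * (net.W ℓ j i * z (ℓ + 1) i) := fun i hi => by
        rw [← hgU (ℓ + 1) hℓ i (Finset.mem_range.1 hi), hprdef]
        ring
      rw [Finset.sum_congr rfl hterm, ← Finset.mul_sum]
      rcases (hU0 ℓ j).eq_or_lt with h | h
      · have hzero : ∑ i ∈ Finset.range (d (ℓ + 1)), net.W ℓ j i * z (ℓ + 1) i = 0 := by
          refine Finset.sum_eq_zero fun i hi => ?_
          have h1 := (Finset.sum_eq_zero_iff_of_nonneg fun i _ =>
            mul_nonneg (net.W_nonneg ℓ j i) (hU0 (ℓ + 1) i)).1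
              ((hUstep ℓ hℓ j).symm.trans h.symm) i hi
          rw [← hgU (ℓ + 1) hℓ i (Finset.mem_range.1 hi), ← mul_assoc, h1, zero_mul]
        simp only [hmdef, hzero, zero_div, mul_zero]
      · simp only [hmdef, hpdef]
        field_simp
    have hp0 : p 0 0 = 1 := by simpa [hd0] using hp1 0 (Nat.zero_le _)
    have herr := sum_prod_mul_sq_pathOutput_sub_le hL hd0 J hJ pr p hpr hp hp0 hrow htrans hq0 hq1
      hqsum hn hc0 hc hcn (fun ℓ j => decide (j < d ℓ / 2)) g m hg hg1 hm
    have hgL : ∀ j, g L j = doubledInput d_in x j := fun j => by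
      simp [hgdef, hz, hU, zRev, unitIn, doubledInput]
    have heval : net.eval x = V * m 0 0 := by
      have hV2 : V = net.w0 * U 0 0 := Vtot_eq hd0 net
      have hUpos : U 0 0 ≠ 0 := fun h => hV.ne' (by rw [hV2, h, mul_zero])
      rw [hV2, hmdef, eval, mul_assoc, mul_div_cancel₀ _ hUpos]
    have hterm : ∀ s : Fin n → Ω,
        |net.eval x - (sampledNet L d_in d α fun ℓ k => J ℓ (s k)).eval x| ^ 2 =
        V ^ 2 * (c / (n + 1) * ∑ k, pathOutput L
          (fun ℓ k => (decide (J ℓ (s k) < d ℓ / 2), J ℓ (s k)))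
          (fun k => g L (J L (s k))) (L - 1) k - m 0 0) ^ 2 := fun s => by
      rw [sq_abs, eval_sampledNet hL hd0 hα0 _ (hJs s), heval, hα]
      simp only [hgL]
      ring
    have hcomm : ∀ a b e : ℝ, a * (b * e) = b * (a * e) := fun a b e => by ring
    simp only [hterm, hcomm _ (V ^ 2), ← Finset.mul_sum]
    refine (mul_le_mul_of_nonneg_left herr (sq_nonneg V)).trans ?_
    rw [← hT, ← mul_div_assoc, ← mul_pow, ← mul_pow]
    gcongr
  have hmean : ∑ s, w s *
      ∫ x, |net.eval x - (sampledNet L d_in d α fun ℓ k => J ℓ (s k)).eval x| ^ 2 ∂P ≤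
        (L : ℝ) ^ 2 * v ^ 2 / (n + 1) := by
    have hI : ∀ s : Fin n → Ω, Integrable (fun x =>
        |net.eval x - (sampledNet L d_in d α fun ℓ k => J ℓ (s k)).eval x| ^ 2) P := fun s =>
      integrable_abs_eval_sub_sq hL hd0 hdL _ _ P hP
    simp only [← integral_const_mul]
    rw [← integral_finsetSum _ fun s _ => (hI s).const_mul _]
    refine (integral_mono_ae (integrable_finsetSum _ fun s _ => (hI s).const_mul _)
      (integrable_const _) (hP.mono fun x hx => hpoint x hx)).trans ?_
    simp
  have hwnn : ∀ s, 0 ≤ w s := fun s => Finset.prod_nonneg fun k _ => hq0 _ _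
  obtain ⟨s, hs, hle⟩ := exists_pos_weight_le w _ hwnn
    (sum_prod_eq_one n q fun k hk => hq1 k (by omega)) hmean
  refine ⟨fun ℓ k => J ℓ (s k), hJs s, ?_, hle⟩
  have hspos : ∀ k : Fin n, 0 < q k (s k) := fun k =>
    (hq0 _ _).lt_of_ne' (Finset.prod_ne_zero_iff.1 hs.ne' k (Finset.mem_univ k))
  rw [compVar_sampledNet hL hd0 hα0 _ (hJs s), Fintype.card_fin]
  have hr := Real.mul_self_sqrt hn1.le
  have hle : Real.sqrt n ≤ Real.sqrt (n + 1) := Real.sqrt_le_sqrt (by linarith)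
  calc α / L * Real.sqrt n * _
      ≤ α / L * Real.sqrt (n + 1) * (Real.sqrt (n + 1) * T) :=
        mul_le_mul (mul_le_mul_of_nonneg_left hle (by positivity)) (hqT s hspos)
          (Finset.sum_nonneg fun _ _ => Finset.sum_nonneg fun _ _ => Real.sqrt_nonneg _)
          (by positivity)
    _ = c * (V * T) / L := by
        rw [hα]
        field_simp
        linear_combination (c * T) * hr
    _ ≤ V * T / L :=
        div_le_div_of_nonneg_right (mul_le_of_le_one_left (mul_nonneg hV.le hT0) hc) hLr.le
    _ ≤ v := by
        rw [div_le_iff₀ hLr]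
        linarith

theorem integral_abs_eval_sq_le (hL : 1 ≤ L) (hd0 : d 0 = 1) (hdL : d L = 2 * d_in)
    (net : RampNet L d_in d) (P : Measure (ℕ → ℝ)) [IsProbabilityMeasure P]
    (hP : ∀ᵐ x ∂P, ∀ i < d_in, |x i| ≤ 1) : ∫ x, |net.eval x| ^ 2 ∂P ≤ net.Vtot ^ 2 := by
  have h := norm_integral_le_of_norm_le_const (μ := P) (f := fun x => |net.eval x| ^ 2)
    (C := net.Vtot ^ 2) (hP.mono fun x hx => by
      rw [Real.norm_eq_abs, abs_pow, abs_abs]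
      exact pow_le_pow_left₀ (abs_nonneg _) (abs_eval_le hL hd0 hdL net hx) 2)
  simpa using (le_abs_self _).trans h

end RampNet

/-- For every positive integer `M` and every `v > 0` there is a subfamily
`F̃ ⊆ F_{L,v}` of cardinality at most
`exp((L−2)·M·log(min{d̄, 2M}) + M·log(8e·d_in))` such that for every probability measure
`P` on `[−1,1]^{d_in}` and every depth-`L` nonnegative-weight ramp network `W` with
composite variation `v(W) ≤ v` there is `f̃ ∈ F̃` with
`∫ |f(W,x) − f̃(x)|² dP(x) ≤ L²·v²/M`. -/
theorem statement0
    (L d_in : ℕ) (hL : 2 ≤ L) (hdin : 1 ≤ d_in)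
    (d : ℕ → ℕ) (hd0 : d 0 = 1) (hdL : d L = 2 * d_in)
    (hdmid : ∀ ℓ, 0 < ℓ → ℓ < L → Even (d ℓ) ∧ 2 ≤ d ℓ)
    (M : ℕ) (hM : 0 < M) (v : ℝ) (hv : 0 < v) :
    ∃ Ftil : Finset ((ℕ → ℝ) → ℝ),
      ↑Ftil ⊆ FLv L d_in d v ∧
      (Ftil.card : ℝ) ≤
        Real.exp (((L : ℝ) - 2) * M * Real.log (min (dbar L d) (2 * M)) +
          M * Real.log (8 * Real.exp 1 * d_in)) ∧
      ∀ P : Measure (ℕ → ℝ), IsProbabilityMeasure P →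
        (∀ᵐ x ∂P, ∀ i < d_in, |x i| ≤ 1) →
        ∀ net : RampNet L d_in d, net.compVar ≤ v →
          ∃ g ∈ Ftil, ∫ x, |net.eval x - g x| ^ 2 ∂P ≤ (L : ℝ) ^ 2 * v ^ 2 / M := by
  classical
  obtain ⟨n, rfl⟩ : ∃ n, M = n + 1 := ⟨M - 1, by omega⟩
  have hL0 : 0 < L := by omega
  have hn1 : (0 : ℝ) < ((n + 1 : ℕ) : ℝ) := by exact_mod_cast hM
  have hd : ∀ ℓ ≤ L, 0 < d ℓ := fun ℓ hℓ => by
    rcases Nat.eq_zero_or_pos ℓ with rfl | h0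
    · omega
    · rcases hℓ.eq_or_lt with rfl | h1
      · omega
      · exact lt_of_lt_of_le two_pos (hdmid ℓ h0 h1).2
  set decode : Fin (n + 1 + 1) × PathCode L d_in d (n + 1) n → (ℕ → ℝ) → ℝ := fun c x =>
    v * (c.1 : ℕ) / (n + 1 : ℕ) / (n + 1 : ℕ) * ∑ k, pathOutput L (decodeLabel c.2)
      (fun k => doubledInput d_in x (c.2.2.2 k)) (L - 1) k with hdecode
  refine ⟨(Finset.univ.image decode).filter (· ∈ FLv L d_in d v), fun g hg => by
    simpa using (Finset.mem_filter.1 hg).2, ?_, ?_⟩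
  · refine le_trans ?_ (card_pathCode_le hL hdin (fun ℓ h0 h1 => (hdmid ℓ h0 h1).2) hM n.le_succ)
    exact_mod_cast (Finset.card_filter_le _ _).trans Finset.card_image_le
  intro P _ hP net hnet
  have hV0 : 0 ≤ net.Vtot := net.Vtot_nonneg
  have hVv : net.Vtot ≤ v := (net.Vtot_le_compVar hL0 hd0).trans hnet
  rcases le_or_gt (net.Vtot ^ 2) ((L : ℝ) ^ 2 * v ^ 2 / (n + 1 : ℕ)) with hsmall | hlarge
  · obtain ⟨code, -⟩ := exists_pathCode (d_in := d_in) (M := n + 1) hdL n.le_succ hL0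
      (fun _ (_ : Fin n) => 0) fun ℓ hℓ _ => hd ℓ hℓ
    have hzero : decode (0, code) = fun _ => 0 := by
      funext x
      simp [hdecode]
    refine ⟨decode (0, code), Finset.mem_filter.2 ⟨Finset.mem_image_of_mem _ (Finset.mem_univ _),
      ⟨0, fun _ _ _ => 0, le_rfl, fun _ _ _ => le_rfl⟩, ?_, ?_⟩, ?_⟩
    · simpa [RampNet.compVar, RampNet.Vtot] using hv.le
    · intro x
      simp [hzero, RampNet.eval]
    · simp only [hzero, sub_zero]
      exact (net.integral_abs_eval_sq_le hL0 hd0 hdL P hP).trans hsmall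
  · have hV : 0 < net.Vtot := hV0.lt_of_ne fun h => by
      rw [← h, zero_pow two_ne_zero] at hlarge
      exact absurd hlarge (not_lt.2 (by positivity))
    set V := net.Vtot
    rw [div_lt_iff₀ hn1] at hlarge
    have hL2 : (2 : ℝ) ≤ L := by exact_mod_cast hL
    have hLv : 4 * v ^ 2 ≤ (L : ℝ) ^ 2 * v ^ 2 := by
      gcongr
      nlinarith
    have hV2 : V ^ 2 ≤ v ^ 2 := by gcongr
    have hn : 4 ≤ n := by
      have h : (4 : ℝ) < ((n + 1 : ℕ) : ℝ) := by
        by_contra! h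
        nlinarith [mul_le_mul hV2 h hn1.le (sq_nonneg v)]
      have h' : 4 < n + 1 := by exact_mod_cast h
      omega
    set i := ⌊V * (n + 1 : ℕ) / v⌋₊ with hi
    have hile : (i : ℝ) * v ≤ V * (n + 1 : ℕ) := by
      rw [← le_div_iff₀ hv]
      exact Nat.floor_le (by positivity)
    have hilt : V * (n + 1 : ℕ) < (i + 1) * v := by
      rw [← div_lt_iff₀ hv]
      exact Nat.lt_floor_add_one _
    have hiM : i ≤ n + 1 := by
      have h : (i : ℝ) * v ≤ ((n + 1 : ℕ) : ℝ) * v :=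
        hile.trans (by rw [mul_comm]; gcongr)
      exact_mod_cast le_of_mul_le_mul_right h hv
    have hMV : 0 < ((n + 1 : ℕ) : ℝ) * V := mul_pos hn1 hV
    have hc0 : 0 ≤ v * i / ((n + 1 : ℕ) * V) := by positivity
    have hc1 : v * i / ((n + 1 : ℕ) * V) ≤ 1 := by
      rw [div_le_one hMV]
      linarith
    have hclose : 1 - v * i / ((n + 1 : ℕ) * V) ≤ v / ((n + 1 : ℕ) * V) := by
      rw [sub_le_iff_le_add, ← add_div, one_le_div hMV]
      linarith
    have hcn : (1 - v * i / ((n + 1 : ℕ) * V)) ^ 2 * (4 * ((n : ℝ) + 1)) ≤ 1 := by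
      have h := pow_le_pow_left₀ (sub_nonneg.2 hc1) hclose 2
      refine (mul_le_mul_of_nonneg_right h (by positivity)).trans ?_
      rw [div_pow, div_mul_eq_mul_div, div_le_one (by positivity)]
      have h2 := mul_le_mul_of_nonneg_right (hLv.trans hlarge.le) hn1.le
      push_cast at h2 ⊢
      nlinarith
    obtain ⟨J, hJ, hcomp, herr⟩ := RampNet.exists_sampledNet hL0 hd0 hdL net hV hnet hn hc0 hc1
      hcn P hP
    obtain ⟨code, hcode⟩ := exists_pathCode hdL n.le_succ hL0 J hJ
    set α := V * (v * i / ((n + 1 : ℕ) * V)) / ((n : ℝ) + 1) with hα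
    have hα0 : 0 ≤ α := by positivity
    have hαi : v * i / (n + 1 : ℕ) / (n + 1 : ℕ) = α := by
      rw [hα]
      push_cast
      field_simp
    have hdec : ∀ x, decode (⟨i, by omega⟩, code) x = (sampledNet L d_in d α J).eval x :=
      fun x => by
        rw [eval_sampledNet hL0 hd0 hα0 J hJ x, hcode (doubledInput d_in x), ← hαi]
    refine ⟨decode (⟨i, by omega⟩, code), Finset.mem_filter.2
      ⟨Finset.mem_image_of_mem _ (Finset.mem_univ _), sampledNet L d_in d α J, hcomp, hdec⟩, ?_⟩
    simp only [hdec]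
    exact_mod_cast herr
end
end

section
/- Let N and T be integers with N ≥ 10 and 1 ≤ T ≤ N/10, and let S = { a ∈ {0,1}^N : Σ_{i=1}^N a_i = T }. Then there exists a subset A ⊆ S of cardinality at least √(C(N,T)) such that any two distinct elements of A have Hamming distance at least T/5. -/
noncomputable section

/-- A maximal `R`-independent subset of a finite set dominates it. -/
theorem exists_independent_dominating {α : Type*} [DecidableEq α] (S : Finset α)
    (R : α → α → Prop) [DecidableRel R] (hrefl : ∀ a, R a a) (hsymm : ∀ a b, R a b → R b a) :
    ∃ A ⊆ S, (∀ a ∈ A, ∀ b ∈ A, a ≠ b → ¬ R a b) ∧ S ⊆ A.biUnion fun a => S.filter (R a) := by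
  classical
  obtain ⟨A, hA, hmax⟩ :=
    (S.powerset.filter fun A => ∀ a ∈ A, ∀ b ∈ A, a ≠ b → ¬ R a b).exists_max_image
      Finset.card ⟨∅, by simp⟩
  simp only [Finset.mem_filter, Finset.mem_powerset] at hA hmax
  refine ⟨A, hA.1, hA.2, fun s hs => ?_⟩
  by_contra hcon
  simp only [Finset.mem_biUnion, Finset.mem_filter, not_exists, not_and] at hcon
  have hfar : ∀ a ∈ A, ¬ R a s := fun a ha => hcon a ha hs
  have hsA : s ∉ A := fun h => hfar s h (hrefl s)
  have hle := hmax (insert s A) ⟨Finset.insert_subset hs hA.1, by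
    intro a ha b hb hab
    rcases Finset.mem_insert.1 ha with rfl | ha <;> rcases Finset.mem_insert.1 hb with rfl | hb
    · exact absurd rfl hab
    · exact fun h => hfar b hb (hsymm _ _ h)
    · exact hfar a ‹a ∈ A›
    · exact hA.2 a ha b hb hab⟩
  rw [Finset.card_insert_of_notMem hsA] at hle
  omega

theorem pow_le_choose_of_mul_le (r : ℝ) (hr : 1 ≤ r) :
    ∀ T N : ℕ, r * T ≤ N → r ^ T ≤ N.choose T
  | 0, N, _ => by simp
  | T + 1, 0, h => by
    push_cast at h
    nlinarith [(T.cast_nonneg : (0 : ℝ) ≤ T)]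
  | T + 1, N + 1, h => by
    push_cast at h
    have ih := pow_le_choose_of_mul_le r hr T N (by linarith)
    have hrec : ((N : ℝ) + 1) * N.choose T = (N + 1).choose (T + 1) * (T + 1) := by
      exact_mod_cast Nat.add_one_mul_choose_eq N T
    have hT : (0 : ℝ) < T + 1 := by positivity
    refine le_of_mul_le_mul_right ?_ hT
    rw [← hrec]
    calc r ^ (T + 1) * ((T : ℝ) + 1) = (r * (T + 1)) * r ^ T := by ring
      _ ≤ ((N : ℝ) + 1) * N.choose T := by gcongr

/-- Binary strings of length `N` and Hamming weight `T`. -/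
def constantWeight (N T : ℕ) : Finset (Fin N → Fin 2) :=
  Finset.univ.filter fun a => ∑ i, (a i : ℕ) = T

theorem mem_constantWeight {N T : ℕ} {a : Fin N → Fin 2} :
    a ∈ constantWeight N T ↔ ∑ i, (a i : ℕ) = T := by
  simp [constantWeight]

theorem sum_val_eq_card {N : ℕ} (a : Fin N → Fin 2) :
    ∑ i, (a i : ℕ) = (Finset.univ.filter fun i => a i = 1).card := by
  rw [Finset.card_filter]
  refine Finset.sum_congr rfl fun i _ => ?_
  generalize a i = u
  revert u
  decide

theorem choose_le_card_constantWeight (N T : ℕ) : N.choose T ≤ (constantWeight N T).card := by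
  have h : ((Finset.univ : Finset (Fin N)).powersetCard T).card = N.choose T := by simp
  rw [← h]
  refine Finset.card_le_card_of_injOn (fun s i => if i ∈ s then 1 else 0) ?_ ?_
  · intro s hs
    have hs' := (Finset.mem_powersetCard.1 hs).2
    simpa [mem_constantWeight, sum_val_eq_card] using hs'
  · intro s _ t _ hst
    ext i
    have := congrFun hst i
    by_cases h1 : i ∈ s <;> by_cases h2 : i ∈ t <;> simp_all

theorem card_drop_eq_card_gain {N T : ℕ} {a b : Fin N → Fin 2}
    (ha : a ∈ constantWeight N T) (hb : b ∈ constantWeight N T) :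
    (Finset.univ.filter fun i => a i = 1 ∧ b i = 0).card =
      (Finset.univ.filter fun i => a i = 0 ∧ b i = 1).card := by
  rw [mem_constantWeight] at ha hb
  have h : ∑ i, ((a i : ℕ) + if a i = 0 ∧ b i = 1 then 1 else 0) =
      ∑ i, ((b i : ℕ) + if a i = 1 ∧ b i = 0 then 1 else 0) := by
    refine Finset.sum_congr rfl fun i _ => ?_
    generalize a i = u
    generalize b i = v
    revert u v
    decide
  rw [Finset.sum_add_distrib, Finset.sum_add_distrib, ha, hb] at h
  rw [Finset.card_filter, Finset.card_filter]
  omega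

theorem hammingDist_eq_card_drop_add_card_gain {N : ℕ} (a b : Fin N → Fin 2) :
    hammingDist a b = (Finset.univ.filter fun i => a i = 1 ∧ b i = 0).card +
      (Finset.univ.filter fun i => a i = 0 ∧ b i = 1).card := by
  rw [hammingDist, Finset.card_filter, Finset.card_filter, Finset.card_filter,
    ← Finset.sum_add_distrib]
  refine Finset.sum_congr rfl fun i _ => ?_
  generalize a i = u
  generalize b i = v
  revert u v
  decide

/-- The weight of a coordinate change: `x` for `1 → 0`, `y` for `0 → 1`. -/
def flipWeight (x y : ℝ) (u v : Fin 2) : ℝ :=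
  (if u = 1 ∧ v = 0 then x else 1) * (if u = 0 ∧ v = 1 then y else 1)

theorem sum_prod_flipWeight_le {N T : ℕ} {a : Fin N → Fin 2} (ha : a ∈ constantWeight N T)
    {x y : ℝ} (hx : 0 ≤ x) (hy : 0 ≤ y) :
    ∑ b : Fin N → Fin 2, ∏ i, flipWeight x y (a i) (b i) ≤ (1 + x) ^ T * (1 + y) ^ N := by
  rw [mem_constantWeight, sum_val_eq_card] at ha
  have h : ∑ b : Fin N → Fin 2, ∏ i, flipWeight x y (a i) (b i) =
      ∏ i, ∑ v, flipWeight x y (a i) v :=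
    (Fintype.prod_sum fun i v => flipWeight x y (a i) v).symm
  rw [h]
  calc ∏ i, ∑ v, flipWeight x y (a i) v
      ≤ ∏ i, ((if a i = 1 then 1 + x else 1) * (1 + y)) := by
        have hpos : ∀ u v, 0 ≤ flipWeight x y u v := by
          intro u v
          unfold flipWeight
          split_ifs <;> positivity
        refine Finset.prod_le_prod (fun i _ => Finset.sum_nonneg fun v _ => hpos _ _) ?_
        intro i _
        generalize a i = u
        fin_cases u
        · simp [flipWeight, Fin.sum_univ_two]
        · simp [flipWeight, Fin.sum_univ_two]
          nlinarith
    _ = (1 + x) ^ T * (1 + y) ^ N := by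
        rw [Finset.prod_mul_distrib, Finset.prod_ite]
        simp [ha]

/-- Chernoff-type bound for the size of a Hamming ball inside the constant weight strings. -/
theorem card_ball_mul_pow_le {N T k : ℕ} {a : Fin N → Fin 2} (ha : a ∈ constantWeight N T)
    {x y : ℝ} (hx : 0 ≤ x) (hy : 0 ≤ y) (hxy : x * y ≤ 1) :
    ((constantWeight N T).filter fun b => hammingDist a b ≤ 2 * k).card * (x * y) ^ k ≤
      (1 + x) ^ T * (1 + y) ^ N := by
  refine le_trans ?_ (sum_prod_flipWeight_le ha hx hy)
  rw [← nsmul_eq_mul, ← Finset.sum_const]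
  refine le_trans (Finset.sum_le_sum fun b hb => ?_)
    (Finset.sum_le_sum_of_subset_of_nonneg (Finset.subset_univ _) fun b _ _ =>
      Finset.prod_nonneg fun i _ => ?_)
  · rw [Finset.mem_filter] at hb
    have h1 := card_drop_eq_card_gain ha hb.1
    have h2 := hammingDist_eq_card_drop_add_card_gain a b
    have h3 := hb.2
    unfold flipWeight
    rw [Finset.prod_mul_distrib, Finset.prod_ite, Finset.prod_ite]
    simp only [Finset.prod_const, one_pow, mul_one]
    rw [← h1, ← mul_pow]
    exact pow_le_pow_of_le_one (by positivity) hxy (by omega)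
  · unfold flipWeight
    split_ifs <;> positivity

theorem card_ball_sq_le_choose {N T : ℕ} (hT : 1 ≤ T) (hTN : (T : ℝ) ≤ (N : ℝ) / 10)
    {a : Fin N → Fin 2} (ha : a ∈ constantWeight N T) :
    (((constantWeight N T).filter fun b => hammingDist a b ≤ 2 * (T / 10)).card : ℝ) ^ 2 ≤
      N.choose T := by
  have hT0 : (0 : ℝ) < T := by exact_mod_cast hT
  obtain ⟨r, hr⟩ : ∃ r : ℝ, r = N / T := ⟨_, rfl⟩
  have hrT : r * T = N := by rw [hr]; field_simp
  have hr10 : 10 ≤ r := by rw [hr, le_div_iff₀ hT0]; linarith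
  have hr0 : 0 < r := by linarith
  have hball := card_ball_mul_pow_le (k := T / 10) ha (x := 1 / 4) (y := 1 / (10 * r))
    (by norm_num) (by positivity) (by
      have : 1 / (10 * r) ≤ 1 := by
        rw [div_le_one (by positivity)]
        linarith
      linarith)
  set V : ℝ := (((constantWeight N T).filter fun b => hammingDist a b ≤ 2 * (T / 10)).card : ℝ)
  have hV : 0 ≤ V := Nat.cast_nonneg _
  have hexp : (1 + 1 / (10 * r)) ^ N ≤ Real.exp (T / 10) := by
    calc (1 + 1 / (10 * r)) ^ N ≤ Real.exp (1 / (10 * r)) ^ N := by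
          gcongr
          linarith [Real.add_one_le_exp (1 / (10 * r))]
      _ = Real.exp (T / 10) := by
          rw [← Real.exp_nat_mul, ← hrT]
          congr 1
          field_simp
  have hVle : V ≤ (40 * r) ^ (T / 10) * ((5 / 4) ^ T * Real.exp (T / 10)) := by
    have hxy : (1 / 4 * (1 / (10 * r)) : ℝ) = (40 * r)⁻¹ := by field_simp; norm_num
    rw [hxy, inv_pow, ← div_eq_mul_inv, div_le_iff₀ (by positivity)] at hball
    refine hball.trans ?_
    rw [mul_comm]
    norm_num at hexp ⊢
    gcongr
  have hchoose : r ^ T ≤ N.choose T := pow_le_choose_of_mul_le r (by linarith) T N hrT.le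
  have he : Real.exp 1 ≤ 3 := by linarith [Real.exp_one_lt_d9]
  have hbase : (40 * r) ^ 2 * ((5 / 4) ^ 20 * Real.exp 1 ^ 2) ≤ r ^ 10 := by
    calc (40 * r) ^ 2 * ((5 / 4) ^ 20 * Real.exp 1 ^ 2)
        ≤ (40 * r) ^ 2 * ((5 / 4) ^ 20 * 3 ^ 2) := by gcongr
      _ ≤ r ^ 2 * 10 ^ 8 := by
        rw [mul_pow, mul_comm (40 ^ 2 : ℝ), mul_assoc]
        gcongr
        norm_num
      _ ≤ r ^ 2 * r ^ 8 := by gcongr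
      _ = r ^ 10 := by ring
  have hexp20 : Real.exp (T / 10) ^ 20 = (Real.exp 1 ^ 2) ^ T := by
    rw [← pow_mul, ← Real.exp_nat_mul, ← Real.exp_nat_mul]
    congr 1
    push_cast
    ring
  have hpow : (V ^ 2) ^ 10 ≤ (N.choose T : ℝ) ^ 10 := by
    calc (V ^ 2) ^ 10 = V ^ 20 := by ring
      _ ≤ ((40 * r) ^ (T / 10) * ((5 / 4) ^ T * Real.exp (T / 10))) ^ 20 := by gcongr
      _ = (40 * r) ^ (T / 10 * 20) * (((5 / 4) ^ 20) ^ T * (Real.exp 1 ^ 2) ^ T) := by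
        rw [← hexp20, mul_pow _ _ 20, mul_pow _ _ 20, pow_mul, pow_right_comm (5 / 4 : ℝ) 20 T]
      _ ≤ (40 * r) ^ (2 * T) * (((5 / 4) ^ 20) ^ T * (Real.exp 1 ^ 2) ^ T) := by
        gcongr ?_ * _
        exact pow_le_pow_right₀ (by linarith) (by omega)
      _ = ((40 * r) ^ 2 * ((5 / 4) ^ 20 * Real.exp 1 ^ 2)) ^ T := by
        rw [mul_pow _ _ T, mul_pow _ _ T, pow_mul]
      _ ≤ (r ^ 10) ^ T := by gcongr
      _ = (r ^ T) ^ 10 := by rw [← pow_mul, ← pow_mul, mul_comm]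
      _ ≤ (N.choose T : ℝ) ^ 10 := by gcongr
  exact le_of_pow_le_pow_left₀ (by norm_num) (Nat.cast_nonneg _) hpow

/-- For `N ≥ 10` and `1 ≤ T ≤ N/10`, among the binary strings of
length `N` and Hamming weight `T` there is a subset of cardinality at least `√C(N,T)`
whose distinct elements are pairwise at Hamming distance at least `T/5`. -/
theorem statement10 (N T : ℕ) (hN : 10 ≤ N) (hT : 1 ≤ T) (hTN : (T : ℝ) ≤ (N : ℝ) / 10) :
    ∃ A : Finset (Fin N → Fin 2),
      (∀ a ∈ A, ∑ i, (a i : ℕ) = T) ∧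
      Real.sqrt (N.choose T) ≤ A.card ∧
      ∀ a ∈ A, ∀ b ∈ A, a ≠ b → (T : ℝ) / 5 ≤ hammingDist a b := by
  obtain ⟨A, hAS, hsep, hcov⟩ := exists_independent_dominating (constantWeight N T)
    (fun a b => hammingDist a b ≤ 2 * (T / 10)) (fun a => by simp)
    (fun a b h => by rwa [hammingDist_comm])
  refine ⟨A, fun a ha => mem_constantWeight.1 (hAS ha), ?_, fun a ha b hb hab => ?_⟩
  · have hC : (0 : ℝ) ≤ N.choose T := Nat.cast_nonneg _
    have hball : ∀ a ∈ A,
        (((constantWeight N T).filter fun b => hammingDist a b ≤ 2 * (T / 10)).card : ℝ) ≤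
          Real.sqrt (N.choose T) := fun a ha =>
      Real.le_sqrt_of_sq_le (card_ball_sq_le_choose hT hTN (hAS ha))
    have hcard : (N.choose T : ℝ) ≤ A.card * Real.sqrt (N.choose T) := by
      calc (N.choose T : ℝ) ≤ (constantWeight N T).card := by
            exact_mod_cast choose_le_card_constantWeight N T
        _ ≤ ∑ a ∈ A, (((constantWeight N T).filter fun b =>
              hammingDist a b ≤ 2 * (T / 10)).card : ℝ) := by
            exact_mod_cast (Finset.card_le_card hcov).trans Finset.card_biUnion_le
        _ ≤ ∑ _a ∈ A, Real.sqrt (N.choose T) := Finset.sum_le_sum hball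
        _ = A.card * Real.sqrt (N.choose T) := by rw [Finset.sum_const, nsmul_eq_mul]
    have hTleN : T ≤ N := by
      have : (T : ℝ) ≤ N := by linarith [(N.cast_nonneg : (0 : ℝ) ≤ N)]
      exact_mod_cast this
    have hpos : 0 < Real.sqrt (N.choose T) :=
      Real.sqrt_pos.2 (by exact_mod_cast Nat.choose_pos hTleN)
    refine le_of_mul_le_mul_right ?_ hpos
    rwa [Real.mul_self_sqrt hC]
  · have hfar := hsep a ha b hb hab
    have h1 := card_drop_eq_card_gain (hAS ha) (hAS hb)
    have h2 := hammingDist_eq_card_drop_add_card_gain a b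
    have h3 : T ≤ 5 * hammingDist a b := by omega
    have h4 : (T : ℝ) ≤ 5 * hammingDist a b := by exact_mod_cast h3
    linarith
end
end
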